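/- Let q be a prime number with q ≡ ±1 (mod 8), q ∉ {7, 17}, such that q − 1 or q + 1 is a power of 2. Let G = PSL(2, F_q) and let k be the 2-adic valuation of |G| = q(q−1)(q+1)/2. Then a subgroup H of G fails to be pronormal in G if and only if there exists an integer j with 1 ≤ j ≤ k − 2 such that H is isomorphic to the dihedral group of order 2^j (with the conventions that the dihedral group of order 2 is ℤ/2ℤ and the dihedral group of order 4 is the Klein four-group (ℤ/2ℤ)^2). In particular, every other subgroup of G is pronormal in G. -/

import Mathlib

/-- The conjugate `H^g := g⁻¹ H g` of a subgroup `H` by an element `g`. -/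
def Subgroup.conjugate {G : Type*} [Group G] (H : Subgroup G) (g : G) : Subgroup G :=
  H.map (MulAut.conj g⁻¹).toMonoidHom

/-- A subgroup `H` of a group `G` is pronormal in `G` if for every `g ∈ G` there exists
`x ∈ ⟨H, H^g⟩` such that `H^x = H^g`. -/
def IsPronormal {G : Type*} [Group G] (H : Subgroup G) : Prop :=
  ∀ g : G, ∃ x ∈ (H ⊔ H.conjugate g : Subgroup G), H.conjugate x = H.conjugate g

namespace PronPSL

section basics
variable {G : Type*} [Group G]

theorem mem_conj {H : Subgroup G} {g y : G} : y ∈ H.conjugate g ↔ g * y * g⁻¹ ∈ H := by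
  unfold Subgroup.conjugate
  rw [Subgroup.mem_map]
  constructor
  · rintro ⟨h, hh, rfl⟩
    simpa [mul_assoc] using hh
  · intro h
    exact ⟨_, h, by simp [mul_assoc]⟩

theorem conj_mem_conj {H : Subgroup G} {g y : G} (hy : y ∈ H) : g⁻¹ * y * g ∈ H.conjugate g := by
  rw [mem_conj]; simpa [mul_assoc] using hy

theorem conj_conj (H : Subgroup G) (a b : G) : (H.conjugate a).conjugate b = H.conjugate (a * b) := by
  ext y; simp only [mem_conj, mul_inv_rev, mul_assoc]

theorem conj_one (H : Subgroup G) : H.conjugate 1 = H := by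
  ext y; simp [mem_conj]

theorem conj_mono {H K : Subgroup G} (h : H ≤ K) (g : G) : H.conjugate g ≤ K.conjugate g := by
  intro y hy; rw [mem_conj] at *; exact h hy

theorem card_conj (H : Subgroup G) (g : G) : Nat.card (H.conjugate g) = Nat.card H := by
  unfold Subgroup.conjugate
  exact Subgroup.card_map_of_injective (MulAut.conj g⁻¹).injective

theorem conj_eq_of_mem {H : Subgroup G} {g : G} (hg : g ∈ H) : H.conjugate g = H := by
  ext y; rw [mem_conj, H.mul_mem_cancel_right (H.inv_mem hg), H.mul_mem_cancel_left hg]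

theorem conj_le_of_mem {H K : Subgroup G} {g : G} (h : H ≤ K) (hg : g ∈ K) : H.conjugate g ≤ K := by
  conv_rhs => rw [← conj_eq_of_mem hg]
  exact conj_mono h g

theorem conj_inv_eq {H K : Subgroup G} {g : G} (h : H.conjugate g = K) : K.conjugate g⁻¹ = H := by
  rw [← h, conj_conj]; simp [conj_one]

/-- Reformulation used to build pronormality. -/
theorem pron_of {H : Subgroup G}
    (h : ∀ g : G, ∀ K : Subgroup G, H ≤ K → H.conjugate g ≤ K → K = H ⊔ H.conjugate g →
      ∃ x ∈ K, ∃ y ∈ K, H.conjugate y = H.conjugate (g * x)) : IsPronormal H := by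
  intro g
  obtain ⟨x, hx, y, hy, e⟩ := h g _ le_sup_left le_sup_right rfl
  refine ⟨y * x⁻¹, mul_mem hy (inv_mem hx), ?_⟩
  rw [← conj_conj, e, conj_conj]; simp

theorem card_le_of_le [Finite G] {A B : Subgroup G} (h : A ≤ B) : Nat.card A ≤ Nat.card B :=
  Nat.card_le_card_of_injective _ (Subgroup.inclusion_injective h)

theorem eq_of_le_card [Finite G] {A B : Subgroup G} (h : A ≤ B) (hc : Nat.card B ≤ Nat.card A) : A = B :=
  Subgroup.eq_of_le_of_card_ge h hc

theorem eq_of_cyc [Finite G] {T A B : Subgroup G} (hT : IsCyclic T) (hA : A ≤ T) (hB : B ≤ T)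
    (hc : Nat.card A = Nat.card B) : A = B := by
  classical
  have : Fintype T := Fintype.ofFinite _
  have key : ∀ C : Subgroup G, C ≤ T → Nat.card C = Nat.card A →
      ∀ y : T, (y : G) ∈ C ↔ y ^ Nat.card A = 1 := by
    intro C hC hCc
    have h1 := IsCyclic.card_pow_eq_one_le (α := T) (n := Nat.card A) Nat.card_pos
    have h2 : (Finset.univ.filter (fun y : T => (y : G) ∈ C)) ⊆
        Finset.univ.filter (fun y : T => y ^ Nat.card A = 1) := by
      intro y hy
      simp only [Finset.mem_filter, Finset.mem_univ, true_and] at *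
      have := pow_card_eq_one' (G := C) (x := ⟨y, hy⟩)
      rw [hCc] at this
      ext
      simpa using congrArg Subtype.val this
    have h3 : (Finset.univ.filter (fun y : T => (y : G) ∈ C)).card = Nat.card A := by
      rw [← hCc, ← Nat.card_congr (Subgroup.subgroupOfEquivOfLe hC).toEquiv, Nat.card_eq_fintype_card,
        Fintype.card_subtype]
      rfl
    have h4 := Finset.eq_of_subset_of_card_le h2 (by rw [h3]; convert h1)
    intro y
    have := Finset.ext_iff.1 h4 y
    simpa using this
  ext y
  constructor
  · intro h
    exact (key B hB hc.symm ⟨y, hA h⟩).2 ((key A hA rfl ⟨y, hA h⟩).1 h)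
  · intro h
    exact (key A hA rfl ⟨y, hB h⟩).2 ((key B hB hc.symm ⟨y, hB h⟩).1 h)

theorem sylow_conj [Finite G] (p : ℕ) [Fact p.Prime] {K A B : Subgroup G} (hA : A ≤ K) (hB : B ≤ K)
    (pA : IsPGroup p A) (pB : IsPGroup p B) :
    ∃ x ∈ K, ∃ S : Subgroup G, S ≤ K ∧ IsPGroup p S ∧ A ≤ S ∧ B.conjugate x ≤ S := by
  have pA' : IsPGroup p (A.subgroupOf K) := pA.of_equiv (Subgroup.subgroupOfEquivOfLe hA).symm
  have pB' : IsPGroup p (B.subgroupOf K) := pB.of_equiv (Subgroup.subgroupOfEquivOfLe hB).symm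
  obtain ⟨S, hS⟩ := pA'.exists_le_sylow
  obtain ⟨S', hS'⟩ := pB'.exists_le_sylow
  obtain ⟨c, hc⟩ := MulAction.exists_smul_eq K S' S
  refine ⟨(c⁻¹ : K), (c⁻¹).2, (S : Subgroup K).map K.subtype, Subgroup.map_subtype_le _,
    S.2.map _, ?_, ?_⟩
  · intro y hy
    exact ⟨⟨y, hA hy⟩, hS hy, rfl⟩
  · intro y hy
    rw [mem_conj] at hy
    have h1 := hS' (show (⟨_, hB hy⟩ : K) ∈ B.subgroupOf K from hy)
    have h2 : (c • S' : Sylow p K) = S := hc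
    have h3 : c * ⟨_, hB hy⟩ * c⁻¹ ∈ S := by
      rw [← h2, ← SetLike.mem_coe, Sylow.coe_smul]
      exact ⟨_, h1, by simp⟩
    refine ⟨_, h3, ?_⟩
    simp [mul_assoc]

end basics
end PronPSL

namespace PronPSL

/-- Abstract data on a finite group `G` acting on a set `X` of poles. -/
structure PoleData (G X : Type*) [Group G] [MulAction G X] (q k : ℕ) where
  neg : X → X
  neg_neg : ∀ x, neg (neg x) = x
  neg_ne : ∀ x, neg x ≠ x
  smul_neg : ∀ (g : G) x, g • neg x = neg (g • x)
  fix : ∀ g : G, g ≠ 1 → orderOf g ≠ q → ∃ x, ∀ y, g • y = y ↔ (y = x ∨ y = neg x)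
  rev : ∀ (g : G) x, g • x = neg x → g * g = 1
  cyc : ∀ x : X, IsCyclic (MulAction.stabilizer G x)
  cardstab : ∀ x : X, Odd (Nat.card (MulAction.stabilizer G x)) ∨
    Nat.card (MulAction.stabilizer G x) ∣ 2 ^ (k - 1)
  qstab : ∀ x : X, ¬ q ∣ Nat.card (MulAction.stabilizer G x)
  card : ∃ m, Odd m ∧ ¬ q ∣ 2 ^ k * m ∧ Nat.card G = q * (2 ^ k * m)
  hk : 3 ≤ k
  hq : q.Prime
  hq2 : q ≠ 2
  comm : ∀ Q : Subgroup G, Nat.card Q = q → ∀ b c, Q.conjugate b = Q → Q.conjugate c = Q →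
    b * c * b⁻¹ * c⁻¹ ∈ Q
  gen : ∀ Q R : Subgroup G, Nat.card Q = q → Nat.card R = q → Q ≠ R → Q ⊔ R = ⊤
  invol : ∀ s t : G, s * s = 1 → t * t = 1 → s ≠ 1 → t ≠ 1 → s ≠ t → s * t = t * s →
    ∃ g : G, g⁻¹ * s * g = t

set_option linter.unusedSectionVars false
namespace PoleData
open MulAction
variable {G X : Type*} [Group G] [Finite G] [MulAction G X] {q k : ℕ}

theorem stab_neg (D : PoleData G X q k) {g : G} {x : X} (h : g • x = x) : g • D.neg x = D.neg x := by
  rw [D.smul_neg, h]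

theorem orderOf_ne (D : PoleData G X q k) {g : G} {x : X} (h : g • x = x) : orderOf g ≠ q := by
  intro e
  apply D.qstab x
  rw [← e]
  exact Subgroup.orderOf_dvd_natCard (stabilizer G x) h

theorem uniq (D : PoleData G X q k) {g : G} (hg : g ≠ 1) {y z : X} (hy : g • y = y) (hz : g • z = z) :
    z = y ∨ z = D.neg y := by
  obtain ⟨x, hx⟩ := D.fix g hg (D.orderOf_ne hy)
  rcases (hx y).1 hy with rfl | rfl
  · exact (hx z).1 hz
  · rw [D.neg_neg]; exact ((hx z).1 hz).symm

/-- stabilizer of the pair `{x, -x}` -/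
def N (D : PoleData G X q k) (x : X) : Subgroup G where
  carrier := {g | g • x = x ∨ g • x = D.neg x}
  one_mem' := by simp
  mul_mem' := by
    rintro a b (ha | ha) (hb | hb) <;> simp [mul_smul, ha, hb, D.smul_neg, D.neg_neg]
  inv_mem' := by
    rintro a (ha | ha)
    · left; rw [inv_smul_eq_iff, ha]
    · right; rw [inv_smul_eq_iff, D.smul_neg, ha, D.neg_neg]

theorem mem_N (D : PoleData G X q k) {g : G} {x : X} : g ∈ D.N x ↔ (g • x = x ∨ g • x = D.neg x) := Iff.rfl

theorem stab_le_N (D : PoleData G X q k) (x : X) : stabilizer G x ≤ D.N x := fun _ h => Or.inl h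

theorem inverts (D : PoleData G X q k) {s c : G} {x : X} (hs : s • x = D.neg x) (hc : c • x = x) : s * c * s = c⁻¹ := by
  have := D.rev (s * c) x (by rw [mul_smul, hc, hs])
  rw [eq_inv_iff_mul_eq_one]; simpa [mul_assoc] using this

theorem mem_N_of (D : PoleData G X q k) {z h : G} {x : X} (hz : z ≠ 1) (hx : z • x = x) (hh : (h⁻¹ * z * h) • x = x) :
    h ∈ D.N x := by
  have : z • (h • x) = h • x := by
    rw [mul_smul, mul_smul, inv_smul_eq_iff] at hh; exact hh
  exact D.uniq hz hx this

theorem stab_conj (D : PoleData G X q k) {h c : G} {x : X} (hh : h ∈ D.N x) (hc : c • x = x) : (h * c * h⁻¹) • x = x := by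
  have h' := inv_mem hh
  rw [mul_smul, mul_smul]
  rcases h' with e | e
  · rw [e, hc]; conv_lhs => rw [← e, smul_inv_smul]
  · rw [e, D.stab_neg hc, ← e, smul_inv_smul]

theorem stab_conj_eq (D : PoleData G X q k) {h : G} {x : X} (hh : h ∈ D.N x) :
    (stabilizer G x).conjugate h = stabilizer G x := by
  apply eq_of_le_card _ (card_conj _ _).ge
  intro y hy
  rw [mem_conj] at hy
  have := D.stab_conj (inv_mem hh) hy
  simpa [mul_assoc] using this

theorem mem_stab_of_ord (D : PoleData G X q k) {g : G} {x : X} (hg : g ∈ D.N x) (h : g * g ≠ 1) : g • x = x := by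
  rcases hg with e | e
  · exact e
  · exact absurd (D.rev _ _ e) h

theorem pow_mem_stab_odd (D : PoleData G X q k) {g : G} {x : X} (hg : g ∈ D.N x) (h : Odd (orderOf g)) : g • x = x := by
  rcases hg with e | e
  · exact e
  · have := orderOf_dvd_of_pow_eq_one (show g ^ 2 = 1 by rw [pow_two]; exact D.rev _ _ e)
    rcases (Nat.dvd_prime Nat.prime_two).1 this with h1 | h1
    · rw [orderOf_eq_one_iff] at h1; simp [h1]
    · rw [h1] at h; exact absurd h (by decide)

theorem card_inf (D : PoleData G X q k) {H : Subgroup G} {x : X} (hH : H ≤ D.N x) {s : G} (hs : s ∈ H)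
    (hsx : s • x = D.neg x) : Nat.card H = 2 * Nat.card (H ⊓ stabilizer G x : Subgroup G) := by
  have h1 : ((H ⊓ stabilizer G x).subgroupOf H).index = 2 := by
    rw [Subgroup.index_eq_two_iff]
    refine ⟨⟨s, hs⟩, fun b => ?_⟩
    simp only [Subgroup.mem_subgroupOf, Subgroup.mem_inf, Subgroup.coe_mul, mem_stabilizer_iff]
    have hb := hH b.2
    rcases hb with e | e
    · refine Or.inr ⟨⟨b.2, e⟩, fun h => ?_⟩
      rw [mul_smul, hsx, D.smul_neg, e] at h
      exact D.neg_ne _ h.2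
    · refine Or.inl ⟨⟨mul_mem b.2 hs, ?_⟩, fun h => ?_⟩
      · rw [mul_smul, hsx, D.smul_neg, e, D.neg_neg]
      · rw [e] at h; exact D.neg_ne _ h.2
  have h2 := Subgroup.card_mul_index ((H ⊓ stabilizer G x).subgroupOf H)
  rw [h1, Nat.card_congr (Subgroup.subgroupOfEquivOfLe inf_le_left).toEquiv] at h2
  omega

theorem exists_rev_or (D : PoleData G X q k) {H : Subgroup G} {x : X} (hH : H ≤ D.N x) :
    H ≤ stabilizer G x ∨ ∃ s ∈ H, s • x = D.neg x := by
  by_cases h : ∃ s ∈ H, s • x = D.neg x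
  · exact Or.inr h
  · left
    push Not at h
    intro g hg
    exact (hH hg).resolve_right (h g hg)

theorem abelian_fix (D : PoleData G X q k) {H : Subgroup G} {z : G} (hz : z ≠ 1) (hzq : orderOf z ≠ q)
    (hc : ∀ h ∈ H, h * z = z * h) : ∃ x, z • x = x ∧ H ≤ D.N x := by
  obtain ⟨x, hx⟩ := D.fix z hz hzq
  have zx := (hx x).2 (Or.inl rfl)
  refine ⟨x, zx, fun h hh => D.mem_N_of hz zx ?_⟩
  rw [mul_assoc, ← hc h hh, inv_mul_cancel_left, zx]

theorem pgroup_fix (D : PoleData G X q k) (p : ℕ) [hp : Fact p.Prime] (hpq : p ≠ q) {S : Subgroup G} (hS : IsPGroup p S)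
    (hne : S ≠ ⊥) : ∃ z ∈ S, z ≠ 1 ∧ ∃ x, z • x = x ∧ S ≤ D.N x := by
  have : Nontrivial S := (Subgroup.nontrivial_iff_ne_bot S).2 hne
  have := hS.center_nontrivial
  obtain ⟨z, hz⟩ := exists_ne (1 : Subgroup.center S)
  have hz1 : ((z : S) : G) ≠ 1 := by
    intro h; apply hz; ext; exact h
  refine ⟨z, (z : S).2, hz1, D.abelian_fix hz1 ?_ ?_⟩
  · rw [Subgroup.orderOf_coe]
    intro e
    obtain ⟨n, hn⟩ := (IsPGroup.iff_orderOf.1 hS) z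
    rw [hn] at e
    have := D.hq
    rw [← e] at this
    have h1 := this.eq_one_of_pow
    subst h1
    simp at e
    exact hpq e
  · intro h hh
    have := Subgroup.mem_center_iff.1 z.2 ⟨h, hh⟩
    exact congrArg Subtype.val this

theorem dvd_two_pow_of_even (D : PoleData G X q k) {x : X} {z : G} (hzx : z • x = x) (hz : orderOf z = 2) :
    Nat.card (stabilizer G x) ∣ 2 ^ (k - 1) := by
  rcases D.cardstab x with h | h
  · have := Subgroup.orderOf_dvd_natCard (stabilizer G x) hzx
    rw [hz] at this
    exact absurd (even_iff_two_dvd.2 this) (Nat.not_even_iff_odd.2 h)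
  · exact h

theorem two_pow_not_dvd (D : PoleData G X q k) : ¬ 2 ^ (k + 1) ∣ Nat.card G := by
  obtain ⟨m, hm, -, hc⟩ := D.card
  rw [hc, show q * (2 ^ k * m) = 2 ^ k * (q * m) by ring, pow_succ]
  intro h
  have h1 := Nat.dvd_of_mul_dvd_mul_left (by positivity) h
  have h2 : Odd (q * m) := (D.hq.odd_of_ne_two D.hq2).mul hm
  exact (Nat.not_even_iff_odd.2 h2) (even_iff_two_dvd.2 h1)

theorem sylow_card (D : PoleData G X q k) (P : Sylow 2 G) : Nat.card P = 2 ^ k := by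
  obtain ⟨m, hm, -, hc⟩ := D.card
  have h1 : 2 ^ k ∣ Nat.card P := P.pow_dvd_card_of_pow_dvd_card ⟨q * m, by rw [hc]; ring⟩
  obtain ⟨n, hn⟩ := P.2.exists_card_eq
  rw [hn] at h1
  have h2 := (Nat.pow_dvd_pow_iff_le_right (by norm_num : 1 < 2)).1 h1
  rcases h2.lt_or_eq with h | h
  · exfalso
    apply D.two_pow_not_dvd
    exact (pow_dvd_pow 2 h).trans (hn ▸ Subgroup.card_subgroup_dvd_card (P : Subgroup G))
  · exact hn.trans (by rw [h])

/-- Structure of the Sylow 2-subgroups. -/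
theorem two_group (D : PoleData G X q k) {S : Subgroup G} (hS : IsPGroup 2 S) :
    ∃ x, S ≤ D.N x ∧ IsPGroup 2 (D.N x) ∧ Nat.card (D.N x) = 2 ^ k ∧
      Nat.card (stabilizer G x) = 2 ^ (k - 1) ∧ ∃ t : G, t • x = D.neg x := by
  obtain ⟨P, hP⟩ := hS.exists_le_sylow
  have hPc := D.sylow_card P
  have hk := D.hk
  have hne : (P : Subgroup G) ≠ ⊥ := by
    intro h
    have : Nat.card (P : Subgroup G) = 1 := by rw [h]; simp
    rw [this] at hPc
    have := Nat.one_lt_two_pow (n := k) (by omega)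
    omega
  obtain ⟨z, hzP, hz1, x, hzx, hPN⟩ := D.pgroup_fix 2 D.hq2.symm P.2 hne
  -- stabilizer is a 2-group
  have hdvd : Nat.card (stabilizer G x) ∣ 2 ^ (k - 1) := by
    rcases D.cardstab x with h | h
    · exfalso
      have h1 := Subgroup.orderOf_dvd_natCard (stabilizer G x) hzx
      obtain ⟨n, hn⟩ := (IsPGroup.iff_orderOf.1 P.2) ⟨z, hzP⟩
      rw [Subgroup.orderOf_mk] at hn
      rw [hn] at h1
      rcases n with _ | n
      · simp at hn; exact hz1 hn
      · exact (Nat.not_even_iff_odd.2 h) (even_iff_two_dvd.2 ((dvd_pow_self 2 (by omega)).trans h1))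
    · exact h
  have hle := Nat.le_of_dvd (by positivity) hdvd
  have h2k : 2 ^ k = 2 * 2 ^ (k - 1) := by
    rw [← pow_succ']; congr 1; omega
  have hpos : 0 < 2 ^ (k - 1) := by positivity
  rcases D.exists_rev_or hPN with h | ⟨s, hs, hsx⟩
  · have := card_le_of_le h
    change Nat.card P ≤ _ at this
    omega
  · have h1 := D.card_inf (le_refl (D.N x)) (hPN hs) hsx
    rw [inf_eq_right.2 (D.stab_le_N x)] at h1
    have h2 := card_le_of_le hPN
    change Nat.card P ≤ _ at h2
    have h3 : Nat.card (D.N x) = 2 ^ k := by omega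
    exact ⟨x, hP.trans hPN, IsPGroup.of_card h3, h3, by omega, s, hsx⟩

end PoleData
end PronPSL

namespace PronPSL
set_option linter.unusedSectionVars false

/-- elements fixing `H` under conjugation -/
def M {G : Type*} [Group G] (H : Subgroup G) : Subgroup G where
  carrier := {y | H.conjugate y = H}
  one_mem' := conj_one H
  mul_mem' := by
    intro a b (ha : _ = _) (hb : _ = _)
    change H.conjugate (a * b) = H
    rw [← conj_conj, ha, hb]
  inv_mem' := by
    intro a (ha : _ = _)
    exact conj_inv_eq ha

theorem mem_M {G : Type*} [Group G] {H : Subgroup G} {y : G} : y ∈ M H ↔ H.conjugate y = H := Iff.rfl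

theorem le_M {G : Type*} [Group G] (H : Subgroup G) : H ≤ M H := fun _ h => conj_eq_of_mem h

theorem mem_M_of {G : Type*} [Group G] [Finite G] {H : Subgroup G} {y : G}
    (h : ∀ a ∈ H, y⁻¹ * a * y ∈ H) : y ∈ M H := by
  rw [mem_M]
  apply eq_of_le_card _ (card_conj _ _).ge
  intro z hz
  rw [mem_conj] at hz
  have := h _ hz
  simpa [mul_assoc] using this

theorem not_pron_of {G : Type*} [Group G] {H : Subgroup G} (g : G) (h : H.conjugate g ≤ M H)
    (hne : H.conjugate g ≠ H) : ¬ IsPronormal H := by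
  intro hp
  obtain ⟨x, hx, e⟩ := hp g
  have : x ∈ M H := (sup_le (le_M H) h) hx
  rw [mem_M] at this
  exact hne (by rw [← e, this])

namespace PoleData
open MulAction
variable {G X : Type*} [Group G] [Finite G] [MulAction G X] {q k : ℕ}

theorem stab_comm (D : PoleData G X q k) {x : X} {a b : G} (ha : a • x = x) (hb : b • x = x) :
    a * b = b * a := by
  have := D.cyc x
  let _ := IsCyclic.commGroup (α := stabilizer G x)
  exact congrArg Subtype.val (mul_comm (⟨a, ha⟩ : stabilizer G x) ⟨b, hb⟩)

theorem rev_conj (D : PoleData G X q k) {x : X} {s c : G} (hs : s • x = D.neg x) (hc : c • x = x) :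
    c⁻¹ * s * c = s * (c * c) := by
  have h1 := D.inverts hs hc
  have h2 := D.rev _ _ hs
  rw [← h1, mul_assoc (s * c), h2]
  simp [mul_assoc]

theorem q_card (D : PoleData G X q k) {S : Subgroup G} (hS : IsPGroup q S) : Nat.card S ≤ q := by
  obtain ⟨m, -, hm, hc⟩ := D.card
  have : Fact q.Prime := ⟨D.hq⟩
  obtain ⟨n, hn⟩ := hS.exists_card_eq
  rw [hn]
  by_contra h
  have h2 : 2 ≤ n := by
    by_contra h2
    have : n = 0 ∨ n = 1 := by omega
    rcases this with rfl | rfl <;> simp at h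
    exact absurd D.hq.one_lt (by omega)
  have h3 : q ^ 2 ∣ Nat.card G := (pow_dvd_pow q h2).trans (hn ▸ Subgroup.card_subgroup_dvd_card S)
  rw [hc, pow_two] at h3
  exact hm (Nat.dvd_of_mul_dvd_mul_left D.hq.pos h3)

theorem exists_Q (D : PoleData G X q k) {H : Subgroup G} (h : q ∣ Nat.card H) :
    ∃ Q ≤ H, Nat.card Q = q := by
  have : Fact q.Prime := ⟨D.hq⟩
  obtain ⟨a, ha⟩ := exists_prime_orderOf_dvd_card' q h
  refine ⟨Subgroup.zpowers (a : G), by simp, ?_⟩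
  rw [Nat.card_zpowers, Subgroup.orderOf_coe, ha]

theorem pron_top : IsPronormal (⊤ : Subgroup G) := by
  intro g
  exact ⟨1, one_mem _, by ext; simp [mem_conj]⟩

/-- Case B: `q` divides `|H|`. -/
theorem pron_q (D : PoleData G X q k) {H : Subgroup G} (h : q ∣ Nat.card H) : IsPronormal H := by
  have : Fact q.Prime := ⟨D.hq⟩
  obtain ⟨Q, hQH, hQ⟩ := D.exists_Q h
  by_cases hu : ∀ R ≤ H, Nat.card R = q → R = Q
  swap
  · push Not at hu
    obtain ⟨R, hRH, hR, hne⟩ := hu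
    have : H = ⊤ := top_le_iff.1 (by rw [← D.gen R Q hR hQ hne]; exact sup_le hRH hQH)
    rw [this]; exact pron_top
  apply pron_of
  intro g K hHK hgK _
  have pQ : IsPGroup q Q := IsPGroup.of_card (n := 1) (by rw [hQ, pow_one])
  have pQ' : IsPGroup q (Q.conjugate g) := IsPGroup.of_card (n := 1) (by rw [card_conj, hQ, pow_one])
  obtain ⟨x, hx, S, hSK, pS, h1, h2⟩ := sylow_conj q (hQH.trans hHK) ((conj_mono hQH g).trans hgK) pQ pQ'
  have hS := D.q_card pS
  have e1 := eq_of_le_card h1 (by omega)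
  have e2 := eq_of_le_card h2 (by rw [card_conj, card_conj]; omega)
  refine ⟨x, hx, 1, one_mem _, ?_⟩
  rw [conj_one]
  rw [conj_conj, ← e1] at e2
  refine eq_of_le_card ?_ (by rw [card_conj])
  intro y hy
  rw [mem_conj]
  have := D.comm Q hQ (g * x) y e2 (hu _ (conj_le_of_mem hQH hy) (by rw [card_conj, hQ]))
  have := mul_mem (hQH this) hy
  simpa [mul_assoc] using this

/-- For odd `p`-subgroups of `H ⊔ H^g`. -/
theorem pron_odd (D : PoleData G X q k) {H : Subgroup G} {x : X} (hH : H ≤ D.N x)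
    (hodd : Odd (Nat.card (stabilizer G x))) (hA : H ⊓ stabilizer G x ≠ ⊥) : IsPronormal H := by
  apply pron_of
  intro g K hHK hgK _
  have hc1 : Nat.card (H ⊓ stabilizer G x : Subgroup G) ≠ 1 := by
    rw [Ne, Subgroup.card_eq_one]; exact hA
  obtain ⟨p, hp, hpd⟩ := Nat.exists_prime_and_dvd hc1
  have : Fact p.Prime := ⟨hp⟩
  obtain ⟨l, hl⟩ := exists_prime_orderOf_dvd_card' p hpd
  have hlH := l.2.1
  have hlx : (l : G) • x = x := l.2.2
  have hlo : orderOf (l : G) = p := by rw [Subgroup.orderOf_coe, hl]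
  have hl1 : (l : G) ≠ 1 := by
    intro h; rw [h, orderOf_one] at hlo; exact hp.one_lt.ne hlo
  have hps : p ∣ Nat.card (stabilizer G x) := by
    rw [← hlo]; exact Subgroup.orderOf_dvd_natCard (stabilizer G x) hlx
  have hpq : p ≠ q := by rintro rfl; exact D.qstab x hps
  have hpodd : Odd p := Odd.of_dvd_nat hodd hps
  set L := Subgroup.zpowers (l : G) with hL
  have hLH : L ≤ H := by simpa [hL] using hlH
  have cL : Nat.card L = p := by rw [Nat.card_zpowers, hlo]
  have pL : IsPGroup p L := IsPGroup.of_card (n := 1) (by rw [cL, pow_one])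
  have pL' : IsPGroup p (L.conjugate g) := IsPGroup.of_card (n := 1) (by rw [card_conj, cL, pow_one])
  obtain ⟨c, hc, S, hSK, pS, h1, h2⟩ := sylow_conj p (hLH.trans hHK) ((conj_mono hLH g).trans hgK) pL pL'
  rw [conj_conj] at h2
  have hlS : (l : G) ∈ S := h1 (Subgroup.mem_zpowers _)
  have hSb : S ≠ ⊥ := by
    rintro rfl; exact hl1 (Subgroup.mem_bot.1 hlS)
  obtain ⟨-, -, -, y, -, hSy⟩ := D.pgroup_fix p hpq pS hSb
  have hSs : ∀ a ∈ S, a • y = y := by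
    intro a ha
    apply D.pow_mem_stab_odd (hSy ha)
    obtain ⟨n, hn⟩ := (IsPGroup.iff_orderOf.1 pS) ⟨a, ha⟩
    rw [Subgroup.orderOf_mk] at hn
    rw [hn]; exact hpodd.pow
  have hSx : ∀ a ∈ S, a • x = x := by
    intro a ha
    rcases D.uniq hl1 (hSs _ hlS) hlx with e | e
    · rw [e]; exact hSs a ha
    · rw [e]; exact D.stab_neg (hSs a ha)
  set h := g * c with hh
  have hN : h ∈ D.N x :=
    D.mem_N_of hl1 hlx (hSx _ (h2 (conj_mem_conj (Subgroup.mem_zpowers _))))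
  have hsub : (H ⊓ stabilizer G x).conjugate h = H ⊓ stabilizer G x := by
    apply eq_of_cyc (D.cyc x) _ inf_le_right (card_conj _ _)
    calc _ ≤ (stabilizer G x).conjugate h := conj_mono inf_le_right h
      _ = _ := D.stab_conj_eq hN
  have hK' : H.conjugate h ≤ K := by
    rw [hh, ← conj_conj]; exact conj_le_of_mem hgK hc
  refine ⟨c, hc, ?_⟩
  rw [← hh]
  rcases D.exists_rev_or hH with hs | ⟨s, hs, hsx⟩
  · refine ⟨1, one_mem _, ?_⟩
    rw [inf_eq_left.2 hs] at hsub
    rw [hsub, conj_one]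
  · set s' := h⁻¹ * s * h with hs'
    have hs'H : s' ∈ H.conjugate h := conj_mem_conj hs
    have hs'x : s' • x = D.neg x := by
      have h3 : s' ∈ D.N x := mul_mem (mul_mem (inv_mem hN) (hH hs)) hN
      refine h3.resolve_left fun e => ?_
      have := D.stab_conj hN e
      rw [hs'] at this
      simp [mul_assoc] at this
      rw [this] at hsx
      exact D.neg_ne _ hsx.symm
    set t := s * s' with ht
    have htx : t • x = x := by
      rw [ht, mul_smul, hs'x, D.smul_neg, hsx, D.neg_neg]
    have htK : t ∈ K := mul_mem (hHK hs) (hK' hs'H)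
    have hto : Odd (orderOf t) := Odd.of_dvd_nat hodd (Subgroup.orderOf_dvd_natCard _ htx)
    obtain ⟨n, hn⟩ := hto
    set d := t ^ (n + 1) with hd
    have hdd : d * d = t := by
      rw [hd, ← pow_add, show n + 1 + (n + 1) = (2 * n + 1) + 1 by ring, ← hn, pow_succ,
        pow_orderOf_eq_one, one_mul]
    have hdx : d • x = x := (stabilizer G x).pow_mem htx _
    refine ⟨d, pow_mem htK _, ?_⟩
    apply eq_of_le_card _ (by rw [card_conj, card_conj])
    have hA' : ∀ a ∈ H, a • x = x → a ∈ H.conjugate h := by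
      intro a ha hax
      have : a ∈ (H ⊓ stabilizer G x).conjugate h := by rw [hsub]; exact ⟨ha, hax⟩
      exact conj_mono inf_le_left h this
    have hss : s * s = 1 := D.rev _ _ hsx
    have hds : d⁻¹ * s * d = s' := by
      rw [D.rev_conj hsx hdx, hdd, ht, ← mul_assoc, hss, one_mul]
    have hda : ∀ a ∈ H, a • x = x → d⁻¹ * a * d ∈ H.conjugate h := by
      intro a ha hax
      rw [mul_assoc, D.stab_comm hax hdx, inv_mul_cancel_left]
      exact hA' a ha hax
    intro y hy
    rw [mem_conj] at hy
    have : y = d⁻¹ * (d * y * d⁻¹) * d := by simp [mul_assoc]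
    rw [this]
    generalize d * y * d⁻¹ = u at hy
    rcases hH hy with e | e
    · exact hda u hy e
    · have h4 : d⁻¹ * u * d = (d⁻¹ * s * d) * (d⁻¹ * (s * u) * d) := by
        have : u = s * (s * u) := by rw [← mul_assoc, hss, one_mul]
        conv_lhs => rw [this]
        simp [mul_assoc]
      rw [h4, hds]
      refine mul_mem hs'H (hda _ (mul_mem hs hy) ?_)
      rw [mul_smul, e, D.smul_neg, hsx, D.neg_neg]

/-- Case C: `2`-groups. Reduction. -/
theorem two_red (D : PoleData G X q k) {H K : Subgroup G} {g : G} (hH : IsPGroup 2 H)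
    (hHK : H ≤ K) (hgK : H.conjugate g ≤ K) :
    ∃ c ∈ K, ∃ x, H ≤ D.N x ∧ H.conjugate (g * c) ≤ D.N x ∧ IsPGroup 2 (D.N x) ∧
      Nat.card (D.N x) = 2 ^ k ∧ Nat.card (stabilizer G x) = 2 ^ (k - 1) := by
  obtain ⟨n, hn⟩ := hH.exists_card_eq
  obtain ⟨c, hc, S, hSK, pS, h1, h2⟩ := sylow_conj 2 hHK hgK hH
    (IsPGroup.of_card (n := n) (by rw [card_conj, hn]))
  obtain ⟨x, hx, h3, h4, h5, -⟩ := D.two_group pS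
  rw [conj_conj] at h2
  exact ⟨c, hc, x, h1.trans hx, h2.trans hx, h3, h4, h5⟩

theorem cyc_le_stab (D : PoleData G X q k) {H : Subgroup G} (hc : IsCyclic H) (h4 : 2 < Nat.card H)
    {x : X} (hx : H ≤ D.N x) : H ≤ stabilizer G x := by
  obtain ⟨a, ha⟩ := IsCyclic.exists_generator (α := H)
  have ho := orderOf_eq_card_of_forall_mem_zpowers ha
  have hax : (a : G) • x = x := by
    apply D.mem_stab_of_ord (hx a.2)
    intro h
    have h2 : a ^ 2 = 1 := by ext; rw [pow_two]; exact h
    have := orderOf_le_of_pow_eq_one (by norm_num) h2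
    omega
  intro y hy
  obtain ⟨n, hn⟩ := ha ⟨y, hy⟩
  have : y = (a : G) ^ n := by simpa using (congrArg Subtype.val hn).symm
  rw [this]
  exact (stabilizer G x).zpow_mem hax n

theorem cyc_conj {H : Subgroup G} (hc : IsCyclic H) (g : G) : IsCyclic (H.conjugate g) := by
  unfold Subgroup.conjugate
  exact isCyclic_of_surjective
    (H.equivMapOfInjective _ (MulAut.conj g⁻¹).injective).toMonoidHom
    (H.equivMapOfInjective _ (MulAut.conj g⁻¹).injective).surjective

theorem pron_cyc2 (D : PoleData G X q k) {H : Subgroup G} (hH : IsPGroup 2 H) (hc : IsCyclic H)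
    (h4 : 2 < Nat.card H) : IsPronormal H := by
  apply pron_of
  intro g K hHK hgK _
  obtain ⟨c, hcK, x, h1, h2, -⟩ := D.two_red hH hHK hgK
  refine ⟨c, hcK, 1, one_mem _, ?_⟩
  rw [conj_one]
  exact eq_of_cyc (D.cyc x) (D.cyc_le_stab hc h4 h1)
    (D.cyc_le_stab (cyc_conj hc _) (by rwa [card_conj]) h2) (card_conj _ _).symm

theorem normal_index_two {H P : Subgroup G} (hHP : H ≤ P) (hc : Nat.card P = 2 * Nat.card H) :
    P ≤ M H := by
  have h1 : (H.subgroupOf P).index = 2 := by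
    have := Subgroup.card_mul_index (H.subgroupOf P)
    rw [Nat.card_congr (Subgroup.subgroupOfEquivOfLe hHP).toEquiv, hc, mul_comm] at this
    exact Nat.eq_of_mul_eq_mul_right Nat.card_pos this
  have := Subgroup.normal_of_index_eq_two h1
  intro y hy
  apply mem_M_of
  intro a ha
  have := this.conj_mem ⟨a, hHP ha⟩ ha (⟨y, hy⟩⁻¹)
  simpa [Subgroup.mem_subgroupOf] using this

theorem pron_big2 (D : PoleData G X q k) {H : Subgroup G}
    (hc : Nat.card H = 2 ^ k ∨ Nat.card H = 2 ^ (k - 1)) : IsPronormal H := by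
  have hk := D.hk
  have h2k : 2 ^ k = 2 * 2 ^ (k - 1) := by
    rw [← pow_succ']; congr 1; omega
  have hH : IsPGroup 2 H := by
    rcases hc with h | h <;> exact IsPGroup.of_card h
  apply pron_of
  intro g K hHK hgK _
  obtain ⟨c, hcK, x, h1, h2, pN, cN, cS⟩ := D.two_red hH hHK hgK
  refine ⟨c, hcK, 1, one_mem _, ?_⟩
  rw [conj_one]
  generalize g * c = h at *
  rcases hc with hc | hc
  · exact (eq_of_le_card h1 (by omega)).trans (eq_of_le_card h2 (by rw [card_conj]; omega)).symm
  · have n1 := normal_index_two h1 (by omega)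
    have n2 := normal_index_two h2 (by rw [card_conj]; omega)
    have n3 : (D.N x).conjugate h ≤ M (H.conjugate h) := by
      apply normal_index_two (conj_mono h1 h)
      rw [card_conj, card_conj]; omega
    have pN' : IsPGroup 2 ((D.N x).conjugate h) := IsPGroup.of_card (by rw [card_conj, cN])
    obtain ⟨v, hv, S, hS, pS, s1, s2⟩ := sylow_conj 2 n2 n3 pN pN'
    have hcS : Nat.card S ≤ 2 ^ k := by
      obtain ⟨n, hn⟩ := pS.exists_card_eq
      rw [hn]
      apply Nat.pow_le_pow_right (by norm_num)
      by_contra hlt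
      apply D.two_pow_not_dvd
      exact (pow_dvd_pow 2 (by omega : k + 1 ≤ n)).trans (hn ▸ Subgroup.card_subgroup_dvd_card S)
    have e1 := eq_of_le_card s1 (by omega)
    have e2 := eq_of_le_card s2 (by rw [card_conj, card_conj]; omega)
    rw [conj_conj, ← e1] at e2
    -- h * v normalises N x
    have hmem : h * v ∈ D.N x := by
      have hcyc := D.cyc x
      have h3 : 2 < 2 ^ (k - 1) := by
        calc 2 < 2 ^ 2 := by norm_num
          _ ≤ 2 ^ (k - 1) := Nat.pow_le_pow_right (by norm_num) (by omega)
      have h4 : (stabilizer G x).conjugate (h * v) ≤ stabilizer G x := by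
        apply D.cyc_le_stab (cyc_conj hcyc _) (by rw [card_conj]; omega)
        calc _ ≤ (D.N x).conjugate (h * v) := conj_mono (D.stab_le_N x) _
          _ = _ := e2
      have : Nontrivial (stabilizer G x) := (Finite.one_lt_card_iff_nontrivial).1 (by omega)
      obtain ⟨z, hz⟩ := exists_ne (1 : stabilizer G x)
      exact D.mem_N_of (z := z) (fun e => hz (Subtype.ext e)) z.2 (h4 (conj_mem_conj z.2))
    have h5 : H.conjugate (h * v) = H := n1 hmem
    rw [← conj_conj, show (H.conjugate h).conjugate v = H.conjugate h from hv] at h5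
    exact h5.symm

/-- dihedral isomorphism -/
theorem dihedral_iso (D : PoleData G X q k) {H : Subgroup G} {x : X} (hH : H ≤ D.N x) {s : G}
    (hs : s ∈ H) (hsx : s • x = D.neg x) :
    Nonempty (H ≃* DihedralGroup (Nat.card (H ⊓ stabilizer G x : Subgroup G))) := by
  set A := H ⊓ stabilizer G x with hA
  have hcA : IsCyclic A := by
    have := D.cyc x
    exact isCyclic_of_injective (Subgroup.inclusion (inf_le_right : A ≤ stabilizer G x))
      (Subgroup.inclusion_injective _)
  have e := zmodCyclicMulEquiv hcA
  set φ : ZMod (Nat.card A) → G := fun i => (e (Multiplicative.ofAdd i) : G) with hφ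
  have φadd : ∀ i j, φ (i + j) = φ i * φ j := by
    intro i j; simp [hφ, ofAdd_add]
  have φ0 : φ 0 = 1 := by simp [hφ]
  have φmem : ∀ i, φ i ∈ A := fun i => (e (Multiplicative.ofAdd i)).2
  have φx : ∀ i, φ i • x = x := fun i => (φmem i).2
  have φinj : Function.Injective φ := by
    intro i j h
    exact Multiplicative.ofAdd.injective (e.injective (Subtype.ext h))
  have φneg : ∀ i, φ (-i) = (φ i)⁻¹ := by
    intro i
    rw [eq_inv_iff_mul_eq_one, ← φadd, neg_add_cancel, φ0]
  have hss : s * s = 1 := D.rev _ _ hsx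
  have φs : ∀ i, φ i * s = s * φ (-i) := by
    intro i
    have := D.inverts hsx (φx i)
    rw [φneg, ← this, ← mul_assoc, ← mul_assoc, hss, one_mul]
  let f : DihedralGroup (Nat.card A) →* G := MonoidHom.mk'
    (fun d => match d with
      | DihedralGroup.r i => φ i
      | DihedralGroup.sr i => s * φ i) (by
      rintro (i | i) (j | j)
      · simp [φadd]
      · simp only [DihedralGroup.r_mul_sr]
        rw [← mul_assoc, φs, mul_assoc, ← φadd]; congr 2; ring
      · simp [φadd, mul_assoc]
      · simp only [DihedralGroup.sr_mul_sr]
        rw [mul_assoc, ← mul_assoc (φ i), φs, mul_assoc, ← φadd, ← mul_assoc, hss, one_mul]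
        congr 1; ring)
  have fr : ∀ i, f (DihedralGroup.r i) = φ i := fun i => rfl
  have fs : ∀ i, f (DihedralGroup.sr i) = s * φ i := fun i => rfl
  have hsφ : ∀ i j, φ i ≠ s * φ j := by
    intro i j h
    have h1 := φx i
    rw [h, mul_smul, φx, hsx] at h1
    exact D.neg_ne _ h1
  have finj : Function.Injective f := by
    rintro (i | i) (j | j) h
    · rw [fr, fr] at h; rw [φinj h]
    · rw [fr, fs] at h; exact absurd h (hsφ _ _)
    · rw [fr, fs] at h; exact absurd h.symm (hsφ _ _)
    · rw [fs, fs] at h; rw [φinj (mul_left_cancel h)]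
  have hr : f.range = H := by
    apply eq_of_le_card
    · rintro _ ⟨(i | i), rfl⟩
      · exact (φmem i).1
      · exact mul_mem hs (φmem i).1
    · rw [D.card_inf hH hs hsx, ← Nat.card_congr (MonoidHom.ofInjective finj).toEquiv,
        DihedralGroup.nat_card]
  exact ⟨((MonoidHom.ofInjective finj).trans (MulEquiv.subgroupCongr hr)).symm⟩

/-- non-pronormality of dihedral subgroups -/
theorem not_pron_rev (D : PoleData G X q k) {H : Subgroup G} {x : X} (hH : H ≤ D.N x) {s : G}
    (hs : s ∈ H) (hsx : s • x = D.neg x) (hst : Nat.card (stabilizer G x) = 2 ^ (k - 1)) {j : ℕ}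
    (hj : 1 ≤ j) (hjk : j ≤ k - 2) (hc : Nat.card H = 2 ^ j) : ¬ IsPronormal H := by
  have hk := D.hk
  have hcA := D.card_inf hH hs hsx
  have hcA' : Nat.card (H ⊓ stabilizer G x : Subgroup G) = 2 ^ (j - 1) := by
    have : 2 ^ j = 2 * 2 ^ (j - 1) := by rw [← pow_succ']; congr 1; omega
    omega
  have hcyc := D.cyc x
  obtain ⟨r, hr⟩ := IsCyclic.exists_generator (α := stabilizer G x)
  have ho := orderOf_eq_card_of_forall_mem_zpowers hr
  rw [hst] at ho
  have ord : ∀ i, i ≤ k - 1 → orderOf ((r : G) ^ 2 ^ i) = 2 ^ (k - 1 - i) := by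
    intro i hi
    rw [orderOf_pow_of_dvd (by positivity) (by rw [Subgroup.orderOf_coe, ho]; exact pow_dvd_pow 2 hi),
      Subgroup.orderOf_coe, ho, Nat.pow_div hi (by norm_num)]
  set w := (r : G) ^ 2 ^ (k - 2 - j) with hw
  set u := (r : G) ^ 2 ^ (k - 1 - j) with hu
  have hwx : w • x = x := (stabilizer G x).pow_mem r.2 _
  have hux : u • x = x := (stabilizer G x).pow_mem r.2 _
  have hww : w * w = u := by
    rw [hw, hu, ← pow_add, ← two_mul, ← pow_succ']; congr 2; omega
  have huu : u * u = (r : G) ^ 2 ^ (k - j) := by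
    rw [hu, ← pow_add, ← two_mul, ← pow_succ']; congr 2; omega
  have ou : orderOf u = 2 ^ j := by
    rw [hu, ord _ (by omega)]; congr 1; omega
  have ouu : orderOf (u * u) = 2 ^ (j - 1) := by
    rw [huu, ord _ (by omega)]; congr 1; omega
  have huuH : u * u ∈ H := by
    have : Subgroup.zpowers (u * u) = H ⊓ stabilizer G x := by
      apply eq_of_cyc hcyc _ inf_le_right
      · rw [Nat.card_zpowers, ouu, hcA']
      · simp only [Subgroup.zpowers_le]
        exact mul_mem (S := Subgroup G) hux hux
    have h1 : u * u ∈ Subgroup.zpowers (u * u) := Subgroup.mem_zpowers _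
    rw [this] at h1
    exact h1.1
  have hunot : u ∉ H := by
    intro h
    have h1 := Subgroup.orderOf_dvd_natCard (H ⊓ stabilizer G x) (x := u) ⟨h, hux⟩
    rw [ou, hcA', Nat.pow_dvd_pow_iff_le_right (by norm_num)] at h1
    omega
  have huM : u ∈ M H := by
    apply mem_M_of
    intro a ha
    rcases hH ha with e | e
    · rwa [mul_assoc, D.stab_comm e hux, inv_mul_cancel_left]
    · rw [D.rev_conj e hux]; exact mul_mem ha huuH
  apply not_pron_of w
  · intro y hy
    rw [mem_conj] at hy
    have : y = w⁻¹ * (w * y * w⁻¹) * w := by simp [mul_assoc]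
    rw [this]
    generalize w * y * w⁻¹ = a at hy
    rcases hH hy with e | e
    · rw [mul_assoc, D.stab_comm e hwx, inv_mul_cancel_left]
      exact le_M H hy
    · rw [D.rev_conj e hwx, hww]
      exact mul_mem (le_M H hy) huM
  · intro e
    have h1 := conj_mem_conj (g := w) hs
    rw [e, D.rev_conj hsx hwx, hww, H.mul_mem_cancel_left hs] at h1
    exact hunot h1

theorem not_pron (D : PoleData G X q k) {H : Subgroup G} {j : ℕ}
    (hj : 1 ≤ j) (hjk : j ≤ k - 2) (e : H ≃* DihedralGroup (2 ^ (j - 1))) : ¬ IsPronormal H := by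
  have hc : Nat.card H = 2 ^ j := by
    rw [Nat.card_congr e.toEquiv, DihedralGroup.nat_card, ← pow_succ']; congr 1; omega
  obtain ⟨x, h1, -, -, h3, t, ht⟩ := D.two_group (IsPGroup.of_card hc)
  rcases D.exists_rev_or h1 with h | ⟨s, hs, hsx⟩
  swap
  · exact D.not_pron_rev h1 hs hsx h3 hj hjk hc
  have hcyc : IsCyclic H := by
    have := D.cyc x
    exact isCyclic_of_injective (Subgroup.inclusion h) (Subgroup.inclusion_injective _)
  have hcd : IsCyclic (DihedralGroup (2 ^ (j - 1))) :=
    isCyclic_of_surjective e.toMonoidHom e.surjective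
  rw [DihedralGroup.isCyclic_iff] at hcd
  have hj1 : j = 1 := by
    by_contra hne
    have := Nat.one_lt_two_pow (n := j - 1) (by omega)
    omega
  subst hj1
  rw [pow_one] at hc
  obtain ⟨s, hs, hu⟩ : ∃ s ∈ H, s ≠ 1 ∧ ∀ y ∈ H, y = 1 ∨ y = s := by
    obtain ⟨a, b, hab, hall⟩ := Nat.card_eq_two_iff.1 hc
    have hall : ∀ y : H, y = a ∨ y = b := by
      intro y
      have : y ∈ ({a, b} : Set H) := by rw [hall]; trivial
      simpa using this
    rcases hall 1 with h1 | h1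
    · exact ⟨b, b.2, fun e => hab (by rw [← h1]; exact Subtype.ext e.symm), fun y hy => by
        rcases hall ⟨y, hy⟩ with e | e
        · left; rw [← h1] at e; exact congrArg Subtype.val e
        · right; exact congrArg Subtype.val e⟩
    · exact ⟨a, a.2, fun e => hab (by rw [← h1]; exact Subtype.ext e), fun y hy => by
        rcases hall ⟨y, hy⟩ with e | e
        · right; exact congrArg Subtype.val e
        · left; rw [← h1] at e; exact congrArg Subtype.val e⟩
  obtain ⟨hs1, hu⟩ := hu
  have hss : s * s = 1 := by
    rcases hu _ (mul_mem hs hs) with e | e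
    · exact e
    · exact absurd (mul_eq_left.1 e) hs1
  have htt := D.rev _ _ ht
  have hsx : s • x = x := h hs
  have htn : t ∉ H := by
    intro hh
    have : t • x = x := h hh
    rw [ht] at this
    exact D.neg_ne _ this
  have hst : s * t = t * s := by
    have h1 := D.inverts ht hsx
    have h2 : s⁻¹ = s := by rw [inv_eq_iff_mul_eq_one]; exact hss
    rw [h2] at h1
    calc s * t = (t * s * t) * t := by rw [h1]
      _ = t * s := by rw [mul_assoc, htt, mul_one]
  obtain ⟨g, hg⟩ := D.invol s t hss htt hs1 (fun e => htn (e ▸ one_mem H))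
    (fun e => htn (e ▸ hs)) hst
  apply not_pron_of g
  · intro y hy
    rw [mem_conj] at hy
    have : y = g⁻¹ * (g * y * g⁻¹) * g := by simp [mul_assoc]
    rw [this]
    generalize g * y * g⁻¹ = a at hy
    rcases hu a hy with rfl | rfl
    · simp
    · rw [hg]
      apply mem_M_of
      intro b hb
      rcases hu b hb with rfl | rfl
      · simp
      · rwa [mul_assoc, hst, inv_mul_cancel_left]
  · intro e
    apply htn
    rw [← e, ← hg]
    exact conj_mem_conj hs

end PoleData
end PronPSL

namespace PronPSL
set_option linter.unusedSectionVars false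

theorem dickson_num {N a b c m1 m2 m3 : ℕ} (ha : N = a * m1) (hb : N = b * m2) (hc : N = c * m3)
    (ha2 : 2 ≤ a) (hb2 : 2 ≤ b) (hc2 : 2 ≤ c) (h12 : m2 ≤ m1) (h23 : m3 ≤ m2)
    (hs : m1 + m2 + m3 = N + 2) : m3 = 2 ∨ N = 12 ∨ N = 24 ∨ N = 60 := by
  have e1 : a < 3 := by
    by_contra h
    have : 3 * m1 ≤ a * m1 := Nat.mul_le_mul_right _ (by omega)
    omega
  have e2 : a = 2 := by omega
  subst e2
  have e3 : b < 4 := by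
    by_contra h
    have : 4 * m2 ≤ b * m2 := Nat.mul_le_mul_right _ (by omega)
    omega
  have e4 : b = 2 ∨ b = 3 := by omega
  rcases e4 with rfl | rfl
  · omega
  · have e5 : c < 6 := by
      by_contra h
      have : 6 * m3 ≤ c * m3 := Nat.mul_le_mul_right _ (by omega)
      omega
    interval_cases c <;> omega

theorem dickson_num' {N a b c m1 m2 m3 : ℕ} (ha : N = a * m1) (hb : N = b * m2) (hc : N = c * m3)
    (ha2 : 2 ≤ a) (hb2 : 2 ≤ b) (hc2 : 2 ≤ c)
    (hs : m1 + m2 + m3 = N + 2) : (m1 = 2 ∨ m2 = 2 ∨ m3 = 2) ∨ N = 12 ∨ N = 24 ∨ N = 60 := by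
  rcases le_total m2 m1 with h1 | h1 <;> rcases le_total m3 m2 with h2 | h2 <;>
    rcases le_total m3 m1 with h3 | h3
  · have := dickson_num ha hb hc ha2 hb2 hc2 h1 h2 (by omega); omega
  · have := dickson_num ha hb hc ha2 hb2 hc2 h1 h2 (by omega); omega
  · have := dickson_num ha hc hb ha2 hc2 hb2 h3 h2 (by omega); omega
  · have := dickson_num hc ha hb hc2 ha2 hb2 h3 h1 (by omega); omega
  · have := dickson_num hb ha hc hb2 ha2 hc2 h1 h3 (by omega); omega
  · have := dickson_num hb hc ha hb2 hc2 ha2 h2 h3 (by omega); omega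
  · have := dickson_num hc hb ha hc2 hb2 ha2 h2 h1 (by omega); omega
  · have := dickson_num hc hb ha hc2 hb2 ha2 h2 h1 (by omega); omega

namespace PoleData
open MulAction
variable {G X : Type*} [Group G] [Finite G] [MulAction G X] {q k : ℕ}

/-- the poles of a subgroup -/
def poles (K : Subgroup G) (X : Type*) [MulAction G X] : SubMulAction K X where
  carrier := {x | ∃ h ∈ K, h ≠ 1 ∧ h • x = x}
  smul_mem' := by
    rintro ⟨c, hc⟩ x ⟨h, hh, h1, hx⟩
    refine ⟨c * h * c⁻¹, mul_mem (mul_mem hc hh) (inv_mem hc), ?_, ?_⟩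
    · intro e
      apply h1
      rwa [mul_inv_eq_one, mul_eq_left] at e
    · change (c * h * c⁻¹) • (c • x) = c • x
      rw [mul_smul, inv_smul_smul, mul_smul, hx]

theorem small_orbit (D : PoleData G X q k) {K : Subgroup G} (y : poles K X)
    (ho : Nat.card (orbit K y) ≤ 2) : ∃ x, K ≤ D.N x := by
  obtain ⟨x, t, htK, ht1, htx⟩ := y
  refine ⟨x, fun h hK => ?_⟩
  by_contra hN
  set y : poles K X := ⟨x, t, htK, ht1, htx⟩ with hy
  have h1 : h • x ≠ x := fun e => hN (Or.inl e)
  have h2 : t • h • x ≠ h • x := fun e => hN (D.uniq ht1 htx e)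
  have h3 : t • h • x ≠ x := by
    intro e
    apply h1
    exact smul_left_cancel t (e.trans htx.symm)
  let f : Fin 3 → orbit K y := ![⟨y, mem_orbit_self _⟩, ⟨(⟨h, hK⟩ : K) • y, mem_orbit _ _⟩,
    ⟨((⟨t, htK⟩ : K) * ⟨h, hK⟩) • y, mem_orbit _ _⟩]
  have hf : Function.Injective f := by
    intro i j hij
    have hij := congrArg (fun z : orbit K y => ((z : poles K X) : X)) hij
    have f0 : ((f 0 : poles K X) : X) = x := rfl
    have f1 : ((f 1 : poles K X) : X) = h • x := rfl
    have f2 : ((f 2 : poles K X) : X) = t • h • x := mul_smul t h x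
    fin_cases i <;> fin_cases j <;> simp only [Fin.zero_eta, Fin.mk_one, Fin.reduceFinMk, f0, f1, f2] at hij ⊢
    · exact absurd hij.symm h1
    · exact absurd hij.symm h3
    · exact absurd hij h1
    · exact absurd hij.symm h2
    · exact absurd hij h3
    · exact absurd hij h2
  have : Finite (orbit K y) := Set.finite_range _ |>.to_subtype
  have := Nat.card_le_card_of_injective f hf
  rw [Nat.card_eq_fintype_card (α := Fin 3), Fintype.card_fin] at this
  omega

theorem fixed_two (D : PoleData G X q k) {K : Subgroup G} (hq : ¬ q ∣ Nat.card K) {h : K} (h1 : h ≠ 1) :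
    Nat.card (fixedBy (poles K X) h) = 2 := by
  have h1' : (h : G) ≠ 1 := fun e => h1 (Subtype.ext e)
  obtain ⟨x, hx⟩ := D.fix h h1' (fun e => hq (e ▸ Subgroup.orderOf_dvd_natCard K h.2))
  have hx1 : (h : G) • x = x := (hx x).2 (Or.inl rfl)
  have hx2 : (h : G) • D.neg x = D.neg x := (hx _).2 (Or.inr rfl)
  let y1 : poles K X := ⟨x, h, h.2, h1', hx1⟩
  let y2 : poles K X := ⟨D.neg x, h, h.2, h1', hx2⟩
  have : fixedBy (poles K X) h = {y1, y2} := by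
    ext y
    rw [mem_fixedBy]
    constructor
    · intro e
      rcases (hx y).1 (congrArg Subtype.val e) with e | e
      · left; exact Subtype.ext e
      · right; exact Subtype.ext e
    · rintro (e | e)
      · rw [e]; exact Subtype.ext hx1
      · rw [e]; exact Subtype.ext hx2
  rw [this, Nat.card_coe_set_eq, Set.ncard_pair]
  intro e
  exact D.neg_ne x (congrArg Subtype.val e).symm

theorem dickson [Finite X] (D : PoleData G X q k) {K : Subgroup G} (hq : ¬ q ∣ Nat.card K) (hK : K ≠ ⊥) :
    (∃ x, K ≤ D.N x) ∨ Nat.card K = 12 ∨ Nat.card K = 24 ∨ Nat.card K = 60 := by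
  classical
  by_contra hcon
  push Not at hcon
  obtain ⟨hx, hcard⟩ := hcon
  have : Fintype K := Fintype.ofFinite _
  have : Fintype (poles K X) := Fintype.ofFinite _
  have : Fintype (orbitRel.Quotient K (poles K X)) := Fintype.ofFinite _
  have burn := sum_card_fixedBy_eq_card_orbits_mul_card_group K (poles K X)
  set N := Nat.card K with hN
  have hN2 : 2 ≤ N := (Subgroup.one_lt_card_iff_ne_bot K).2 hK
  rw [← Nat.card_eq_fintype_card (α := K), ← hN,
    ← Finset.add_sum_erase _ _ (Finset.mem_univ (1 : K))] at burn
  have b1 : ∑ h ∈ (Finset.univ : Finset K).erase 1, Fintype.card (fixedBy (poles K X) h) = (N - 1) * 2 := by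
    rw [Finset.sum_const_nat (m := 2), Finset.card_erase_of_mem (Finset.mem_univ _), Finset.card_univ,
      ← Nat.card_eq_fintype_card]
    intro h hh
    rw [← Nat.card_eq_fintype_card]
    exact D.fixed_two hq (Finset.ne_of_mem_erase hh)
  have b2 : Fintype.card (fixedBy (poles K X) (1 : K)) = Fintype.card (poles K X) := by
    rw [← Nat.card_eq_fintype_card, fixedBy_one_eq_univ, ← Nat.card_eq_fintype_card]
    exact Nat.card_congr (Equiv.Set.univ _)
  rw [b1, b2] at burn
  have b3 : Fintype.card (poles K X) = ∑ w : orbitRel.Quotient K (poles K X), Nat.card w.orbit := by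
    rw [← Nat.card_eq_fintype_card, Nat.card_congr (selfEquivSigmaOrbits' K (poles K X)), Nat.card_sigma]
  have b4 : ∀ w : orbitRel.Quotient K (poles K X), 2 < Nat.card w.orbit ∧
      ∃ a, 2 ≤ a ∧ N = a * Nat.card w.orbit := by
    intro w
    induction w using Quotient.inductionOn' with | h y => ?_
    rw [orbitRel.Quotient.orbit_mk]
    refine ⟨?_, Nat.card (stabilizer K y), ?_, ?_⟩
    · by_contra h
      exact absurd (D.small_orbit y (by omega)) (by push Not; exact hx)
    · change 1 < _
      rw [Subgroup.one_lt_card_iff_ne_bot]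
      obtain ⟨x, t, htK, ht1, htx⟩ := y
      intro e
      have : (⟨t, htK⟩ : K) ∈ stabilizer K (⟨x, t, htK, ht1, htx⟩ : poles K X) := Subtype.ext htx
      rw [e, Subgroup.mem_bot] at this
      exact ht1 (congrArg Subtype.val this)
    · rw [hN, Nat.card_congr (orbitProdStabilizerEquivGroup K y).symm, Nat.card_prod, mul_comm]
  set r := Fintype.card (orbitRel.Quotient K (poles K X)) with hr
  have b5 : 2 * Fintype.card (poles K X) ≤ r * N := by
    rw [b3, hr, Finset.mul_sum, ← Finset.card_univ, ← smul_eq_mul]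
    apply Finset.sum_le_card_nsmul
    intro w _
    obtain ⟨-, a, ha, e⟩ := b4 w
    rw [e]; exact Nat.mul_le_mul_right _ ha
  have r4 : r < 4 := by
    by_contra h
    have : 4 * N ≤ r * N := Nat.mul_le_mul_right _ (by omega)
    omega
  have hr' : (Finset.univ : Finset (orbitRel.Quotient K (poles K X))).card = r := Finset.card_univ
  have r3 : r = 0 ∨ r = 1 ∨ r = 2 ∨ r = 3 := by omega
  rcases r3 with h | h | h | h
  · rw [h] at burn; omega
  · rw [h] at hr' burn
    obtain ⟨w1, e⟩ := Finset.card_eq_one.1 hr'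
    rw [b3, e, Finset.sum_singleton] at burn
    have := (b4 w1).1
    omega
  · rw [h] at hr' burn
    obtain ⟨w1, w2, hne, e⟩ := Finset.card_eq_two.1 hr'
    rw [b3, e, Finset.sum_pair hne] at burn
    have := (b4 w1).1
    have := (b4 w2).1
    omega
  · rw [h] at hr' burn
    obtain ⟨w1, w2, w3, h12, h13, h23, e⟩ := Finset.card_eq_three.1 hr'
    rw [b3, e, Finset.sum_insert (by simp [h12, h13]), Finset.sum_pair h23] at burn
    obtain ⟨s1, a, ha, ea⟩ := b4 w1
    obtain ⟨s2, b, hb, eb⟩ := b4 w2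
    obtain ⟨s3, c, hc, ec⟩ := b4 w3
    have := dickson_num' ea eb ec ha hb hc (by omega)
    omega

end PoleData
end PronPSL

namespace PronPSL
set_option linter.unusedSectionVars false

theorem card_prod_le {G : Type*} [Group G] [Finite G] {A B L : Subgroup G} (hA : A ≤ L) (hB : B ≤ L) :
    Nat.card A * Nat.card B ≤ Nat.card (A ⊓ B : Subgroup G) * Nat.card L := by
  have key : ∀ {C : Subgroup G}, C ≤ L → Nat.card C * C.relIndex L = Nat.card L := by
    intro C hC
    have := Subgroup.card_mul_index (C.subgroupOf L)
    rwa [Nat.card_congr (Subgroup.subgroupOfEquivOfLe hC).toEquiv] at this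
  have k1 := key hA
  have k2 := key hB
  have k3 := key (inf_le_left.trans hA : A ⊓ B ≤ L)
  have h := Subgroup.relIndex_inf_le (H := A) (K := B) (L := L)
  have hL : 0 < Nat.card L := Nat.card_pos
  generalize A.relIndex L = a at *
  generalize B.relIndex L = b at *
  generalize (A ⊓ B).relIndex L = c at *
  generalize Nat.card A = x at *
  generalize Nat.card B = y at *
  generalize Nat.card (A ⊓ B : Subgroup G) = z at *
  generalize Nat.card L = l at *
  have hab : 0 < a * b := by
    rcases Nat.eq_zero_or_pos (a * b) with h0 | h0
    · rcases Nat.mul_eq_zero.1 h0 with h0 | h0 <;> subst h0 <;> omega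
    · exact h0
  refine Nat.le_of_mul_le_mul_right (c := a * b) ?_ hab
  calc x * y * (a * b) = (x * a) * (y * b) := by ring
    _ = z * c * l := by rw [k1, k2, k3]
    _ ≤ z * (a * b) * l := by gcongr
    _ = _ := by ring

theorem comm_of_card_four {G : Type*} [Group G] {V : Subgroup G} (hV : Nat.card V = 4) :
    ∀ a ∈ V, ∀ b ∈ V, a * b = b * a := by
  intro a ha b hb
  have : Fact (Nat.Prime 2) := ⟨Nat.prime_two⟩
  have h := (IsPGroup.isMulCommutative_of_card_eq_prime_sq (p := 2) (G := V) (by rw [hV]; rfl)).is_comm.comm ⟨a, ha⟩ ⟨b, hb⟩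
  exact congrArg Subtype.val h

theorem centr_five {G : Type*} [Group G] [Finite G] {V : Subgroup G} (hV : Nat.card V = 4) {f : G} (hf : f ∈ M V)
    (hf5 : f ^ 5 = 1) {v : G} (hv : v ∈ V) : f * v = v * f := by
  let φ : Fin 5 → V := fun i => ⟨f ^ (i : ℕ) * v * (f ^ (i : ℕ))⁻¹, by
    have h1 : (f ^ (i : ℕ)) ∈ M V := pow_mem hf _
    rw [← mem_conj, mem_M.1 h1]; exact hv⟩
  have hni : ¬ Function.Injective φ := by
    intro h
    have := Nat.card_le_card_of_injective φ h
    rw [hV, Nat.card_eq_fintype_card, Fintype.card_fin] at this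
    omega
  have key : ∀ d : ℕ, (d = 1 ∨ d = 2 ∨ d = 3 ∨ d = 4) → Commute (f ^ d) v → Commute f v := by
    intro d hd hc
    have : ∃ e n : ℕ, d * e = 5 * n + 1 := by
      rcases hd with rfl | rfl | rfl | rfl
      · exact ⟨1, 0, rfl⟩
      · exact ⟨3, 1, rfl⟩
      · exact ⟨2, 1, rfl⟩
      · exact ⟨4, 3, rfl⟩
    obtain ⟨e, n, hen⟩ := this
    have h := hc.pow_left e
    rwa [← pow_mul, hen, pow_succ, pow_mul, hf5, one_pow, one_mul] at h
  rw [Function.Injective] at hni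
  push Not at hni
  have key2 : ∀ i j : Fin 5, i < j → φ i = φ j → Commute f v := by
    intro i j hlt he
    have he := congrArg Subtype.val he
    change f ^ (i : ℕ) * v * (f ^ (i : ℕ))⁻¹ = f ^ (j : ℕ) * v * (f ^ (j : ℕ))⁻¹ at he
    have hij : (j : ℕ) = i + (j - i : ℕ) := by have : (i : ℕ) < j := hlt; omega
    rw [hij, pow_add] at he
    apply key (j - i : ℕ) (by have : (i : ℕ) < j := hlt; omega)
    generalize f ^ ((j : ℕ) - (i : ℕ)) = u at *
    generalize f ^ (i : ℕ) = w at *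
    have h2 : v = u * v * u⁻¹ := by
      have := congrArg (fun y => w⁻¹ * y * w) he
      simpa [mul_assoc] using this
    change u * v = v * u
    exact (eq_mul_inv_iff_mul_eq.1 h2).symm
  obtain ⟨i, j, he, hne⟩ := hni
  rcases lt_or_gt_of_ne hne with h | h
  · exact key2 i j h he
  · exact key2 j i h he.symm

namespace PoleData
open MulAction
variable {G X : Type*} [Group G] [Finite G] [MulAction G X] {q k : ℕ}

/-- no central element in a subgroup fixing no pair of poles -/
theorem exc_central (D : PoleData G X q k) {H : Subgroup G} (hq : ¬ q ∣ Nat.card H) (hx : ∀ x, ¬ H ≤ D.N x)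
    {z : G} (hz : z ∈ H) (hz1 : z ≠ 1) (hc : H ≤ Subgroup.centralizer {z}) : False := by
  obtain ⟨x, -, h⟩ := D.abelian_fix hz1 (fun e => hq (e ▸ Subgroup.orderOf_dvd_natCard H hz))
    (fun h hh => Subgroup.mem_centralizer_singleton_iff.1 (hc hh))
  exact hx x h

theorem exc_central_twelve (D : PoleData G X q k) {H A B : Subgroup G} (hq : ¬ q ∣ Nat.card H) (hx : ∀ x, ¬ H ≤ D.N x)
    (hH : Nat.card H = 12) (hAc : Nat.card A = 4) (hAH : A ≤ H) (hBH : B ≤ H) (hBA : ¬ B ≤ A)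
    (hB : Nat.card B = 4 ∨ Nat.card B = 6)
    {z : G} (hz : z ∈ H) (hz1 : z ≠ 1) (hA : A ≤ Subgroup.centralizer {z}) (hB : B ≤ Subgroup.centralizer {z}) :
    False := by
  apply D.exc_central hq hx hz hz1
  have h1 : A ≤ H ⊓ Subgroup.centralizer {z} := le_inf hAH hA
  have h2 : B ≤ H ⊓ Subgroup.centralizer {z} := le_inf hBH hB
  have d1 := Subgroup.card_dvd_of_le h1
  have d2 := Subgroup.card_dvd_of_le (inf_le_left : H ⊓ Subgroup.centralizer {z} ≤ H)
  rw [hAc] at d1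
  rw [hH] at d2
  have hle := Nat.le_of_dvd (by norm_num) d2
  have h4 : Nat.card (H ⊓ Subgroup.centralizer {z} : Subgroup G) ≠ 4 := by
    intro e
    have := eq_of_le_card h1 (by omega)
    exact hBA (this ▸ h2)
  have h12 : Nat.card (H ⊓ Subgroup.centralizer {z} : Subgroup G) = 12 := by
    generalize Nat.card (H ⊓ Subgroup.centralizer {z} : Subgroup G) = c at *
    interval_cases c <;> omega
  rw [← eq_of_le_card inf_le_left (by omega : Nat.card H ≤ Nat.card (H ⊓ Subgroup.centralizer {z} : Subgroup G))]
  exact inf_le_right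

theorem exc_V (D : PoleData G X q k) {H V : Subgroup G} (hq : ¬ q ∣ Nat.card H) (hx : ∀ x, ¬ H ≤ D.N x)
    (hH : Nat.card H = 12) (hVH : V ≤ H) (hV : Nat.card V = 4) : H ≤ M V := by
  intro h hh
  by_contra hne
  rw [mem_M] at hne
  have hle := conj_le_of_mem hVH hh
  have hc := card_prod_le hVH hle
  rw [card_conj, hV, hH] at hc
  have : V ⊓ V.conjugate h ≠ ⊥ := by
    intro e
    rw [e, Subgroup.card_bot] at hc
    omega
  obtain ⟨z, hz, hz1⟩ := (Subgroup.ne_bot_iff_exists_ne_one).1 this |>.elim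
    (fun a ha => (⟨a, a.2, fun e => ha (Subtype.ext e)⟩ : ∃ z ∈ V ⊓ V.conjugate h, z ≠ 1))
  refine D.exc_central_twelve hq hx hH hV hVH hle ?_ (Or.inl (by rw [card_conj, hV])) (hVH hz.1) hz1 ?_ ?_
  · intro e
    exact hne (eq_of_le_card e (by rw [card_conj]))
  · intro a ha
    exact Subgroup.mem_centralizer_singleton_iff.2 (comm_of_card_four hV _ ha _ hz.1)
  · intro a ha
    exact Subgroup.mem_centralizer_singleton_iff.2
      (comm_of_card_four (by rw [card_conj, hV]) _ ha _ hz.2)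

theorem exists_sub {H : Subgroup G} (p n : ℕ) [Fact p.Prime] (h : p ^ n ∣ Nat.card H) :
    ∃ V ≤ H, Nat.card V = p ^ n := by
  obtain ⟨V, hV⟩ := Sylow.exists_subgroup_card_pow_prime p h
  exact ⟨V.map H.subtype, Subgroup.map_subtype_le _, by
    rw [Subgroup.card_map_of_injective H.subtype_injective, hV]⟩

theorem exc_no_six (D : PoleData G X q k) {H C : Subgroup G} (hq : ¬ q ∣ Nat.card H) (hx : ∀ x, ¬ H ≤ D.N x)
    (hH : Nat.card H = 12) (hCH : C ≤ H) : Nat.card C ≠ 6 := by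
  intro hC
  have : Fact (Nat.Prime 2) := ⟨Nat.prime_two⟩
  obtain ⟨V, hVH, hV⟩ := exists_sub (H := H) 2 2 (by rw [hH]; norm_num)
  norm_num at hV
  have hn := D.exc_V hq hx hH hVH hV
  have hc := card_prod_le hVH hCH
  rw [hV, hC, hH] at hc
  have d1 := Subgroup.card_dvd_of_le (inf_le_left : V ⊓ C ≤ V)
  have d2 := Subgroup.card_dvd_of_le (inf_le_right : V ⊓ C ≤ C)
  have h2 : Nat.card (V ⊓ C : Subgroup G) = 2 := by
    rw [hV] at d1; rw [hC] at d2
    generalize Nat.card (V ⊓ C : Subgroup G) = c at *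
    have := Nat.le_of_dvd (by norm_num) d1
    interval_cases c <;> omega
  have hne : V ⊓ C ≠ ⊥ := by
    intro e; rw [e, Subgroup.card_bot] at h2; omega
  obtain ⟨z, hz, hz1⟩ := (Subgroup.ne_bot_iff_exists_ne_one).1 hne |>.elim
    (fun a ha => (⟨a, a.2, fun e => ha (Subtype.ext e)⟩ : ∃ z ∈ V ⊓ C, z ≠ 1))
  refine D.exc_central_twelve hq hx hH hV hVH hCH ?_ (Or.inr hC) (hVH hz.1) hz1 ?_ ?_
  · intro e
    have := card_le_of_le e
    omega
  · intro a ha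
    exact Subgroup.mem_centralizer_singleton_iff.2 (comm_of_card_four hV _ ha _ hz.1)
  · intro a ha
    rw [Subgroup.mem_centralizer_singleton_iff]
    have hm : a * z * a⁻¹ ∈ V ⊓ C := by
      refine Subgroup.mem_inf.2 ⟨?_, mul_mem (mul_mem ha hz.2) (inv_mem ha)⟩
      change a * z * a⁻¹ ∈ V
      rw [← mem_conj, mem_M.1 (hn (hCH ha))]
      exact hz.1
    have hm1 : a * z * a⁻¹ ≠ 1 := by
      intro e; apply hz1
      rwa [mul_inv_eq_one, mul_eq_left] at e
    have hu := (Nat.card_eq_two_iff' (1 : (V ⊓ C : Subgroup G))).1 h2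
    have := hu.unique (y₁ := ⟨_, hm⟩) (y₂ := ⟨z, hz⟩) (fun e => hm1 (congrArg Subtype.val e))
      (fun e => hz1 (congrArg Subtype.val e))
    have := congrArg Subtype.val this
    exact mul_inv_eq_iff_eq_mul.1 this

theorem exc_sixty (D : PoleData G X q k) {K V : Subgroup G} (hq : ¬ q ∣ Nat.card K) (hx : ∀ x, ¬ K ≤ D.N x)
    (hK : Nat.card K = 60) (hVK : V ≤ K) (hV : Nat.card V = 4) (hn : K ≤ M V) : False := by
  have : Fact (Nat.Prime 5) := ⟨by norm_num⟩
  obtain ⟨f, hf⟩ := exists_prime_orderOf_dvd_card' (G := K) 5 (by rw [hK]; norm_num)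
  have hf5 : (f : G) ^ 5 = 1 := by rw [← hf, ← Subgroup.orderOf_coe, pow_orderOf_eq_one]
  have hf1 : (f : G) ≠ 1 := by
    intro e
    rw [← Subgroup.orderOf_coe, e, orderOf_one] at hf
    omega
  have hcent : ∀ v ∈ V, (f : G) * v = v * f := fun v hv => centr_five hV (hn f.2) hf5 hv
  -- `V` and `f` fix the same poles
  obtain ⟨x, hfx, hVx⟩ := D.abelian_fix (H := V) hf1
    (fun e => hq (e ▸ Subgroup.orderOf_dvd_natCard K f.2)) (fun v hv => (hcent v hv).symm)
  have hVs : V ≤ stabilizer G x := by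
    intro v hv
    by_cases hv1 : v = 1
    · rw [hv1]; exact one_mem _
    obtain ⟨y, hvy, hfy⟩ := D.abelian_fix (H := Subgroup.zpowers (f : G)) hv1
      (fun e => hq (e ▸ Subgroup.orderOf_dvd_natCard K (hVK hv))) (by
        intro h hh
        obtain ⟨n, rfl⟩ := Subgroup.mem_zpowers_iff.1 hh
        exact Commute.zpow_left (hcent v hv) n)
    have hfy' : (f : G) • y = y := by
      apply D.pow_mem_stab_odd (hfy (Subgroup.mem_zpowers _))
      rw [Subgroup.orderOf_coe, hf]; decide
    rcases D.uniq hf1 hfx hfy' with e | e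
    · rw [← e]; exact hvy
    · rw [e] at hvy
      have := D.stab_neg hvy
      rw [D.neg_neg] at this
      exact this
  have hne : V ≠ ⊥ := by intro e; rw [e, Subgroup.card_bot] at hV; omega
  obtain ⟨z, hz1⟩ := (Subgroup.ne_bot_iff_exists_ne_one).1 hne
  apply hx x
  intro h hh
  refine D.mem_N_of (z := z) (fun e => hz1 (Subtype.ext e)) (hVs z.2) (hVs ?_)
  have := conj_mem_conj (g := h) z.2
  rwa [mem_M.1 (hn hh)] at this

theorem pron_exc [Finite X] (D : PoleData G X q k) {H : Subgroup G} (hq : ¬ q ∣ Nat.card H)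
    (hx : ∀ x, ¬ H ≤ D.N x) (hne : H ≠ ⊥) : IsPronormal H := by
  apply pron_of
  intro g K hHK hgK hK
  have hKx : ∀ x, ¬ K ≤ D.N x := fun x h => hx x (hHK.trans h)
  by_cases hqK : q ∣ Nat.card K
  · obtain ⟨Q, hQK, hQ⟩ := D.exists_Q hqK
    by_cases hu : ∀ R ≤ K, Nat.card R = q → R = Q
    · exfalso
      have hM : ∀ b ∈ K, Q.conjugate b = Q := fun b hb =>
        hu _ (conj_le_of_mem hQK hb) (by rw [card_conj, hQ])
      have hQH : Q ⊓ H = ⊥ := by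
        have d1 := Subgroup.card_dvd_of_le (inf_le_left : Q ⊓ H ≤ Q)
        have d2 := Subgroup.card_dvd_of_le (inf_le_right : Q ⊓ H ≤ H)
        rw [hQ] at d1
        rcases (Nat.dvd_prime D.hq).1 d1 with e | e
        · exact Subgroup.card_eq_one.1 e
        · rw [e] at d2; exact absurd d2 hq
      obtain ⟨z, hz1⟩ := (Subgroup.ne_bot_iff_exists_ne_one).1 hne
      apply D.exc_central hq hx z.2 (fun e => hz1 (Subtype.ext e))
      intro a ha
      rw [Subgroup.mem_centralizer_singleton_iff]
      have h1 := D.comm Q hQ a z (hM _ (hHK ha)) (hM _ (hHK z.2))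
      have h2 : a * z * a⁻¹ * (z : G)⁻¹ ∈ Q ⊓ H :=
        Subgroup.mem_inf.2 ⟨h1, mul_mem (mul_mem (mul_mem ha z.2) (inv_mem ha)) (inv_mem z.2)⟩
      rw [hQH, Subgroup.mem_bot, mul_inv_eq_one, mul_inv_eq_iff_eq_mul] at h2
      exact h2
    · push Not at hu
      obtain ⟨R, hRK, hR, hRQ⟩ := hu
      have : K = ⊤ := top_le_iff.1 (by rw [← D.gen R Q hR hQ hRQ]; exact sup_le hRK hQK)
      exact ⟨1, one_mem _, g, by rw [this]; trivial, by rw [mul_one]⟩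
  have hKne : K ≠ ⊥ := fun e => hne (le_bot_iff.1 (e ▸ hHK))
  have cH := (D.dickson hq hne).resolve_left (by push Not; exact hx)
  have cK := (D.dickson hqK hKne).resolve_left (by push Not; exact hKx)
  have hdvd := Subgroup.card_dvd_of_le hHK
  by_cases heq : Nat.card H = Nat.card K
  · refine ⟨1, one_mem _, 1, one_mem _, ?_⟩
    rw [conj_one, mul_one]
    exact (eq_of_le_card hHK heq.ge).trans (eq_of_le_card hgK (by rw [card_conj]; exact heq.ge)).symm
  have h12 : Nat.card H = 12 ∧ (Nat.card K = 24 ∨ Nat.card K = 60) := by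
    rcases cH with e | e | e <;> rcases cK with f | f | f <;> rw [e, f] at hdvd heq <;> omega
  obtain ⟨hH, hK'⟩ := h12
  rcases hK' with hK' | hK'
  · refine ⟨1, one_mem _, 1, one_mem _, ?_⟩
    rw [conj_one, mul_one]
    by_contra hneq
    have hc := card_prod_le hHK hgK
    rw [card_conj, hH, hK'] at hc
    have d1 := Subgroup.card_dvd_of_le (inf_le_left : H ⊓ H.conjugate g ≤ H)
    have h6 := D.exc_no_six hq hx hH (inf_le_left : H ⊓ H.conjugate g ≤ H)
    have hn12 : Nat.card (H ⊓ H.conjugate g : Subgroup G) ≠ 12 := by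
      intro e
      apply hneq
      exact (eq_of_le_card inf_le_left (by omega : Nat.card H ≤ Nat.card (H ⊓ H.conjugate g : Subgroup G))).symm.trans
        (eq_of_le_card inf_le_right (by rw [card_conj]; omega))
    rw [hH] at d1
    have := Nat.le_of_dvd (by norm_num) d1
    generalize Nat.card (H ⊓ H.conjugate g : Subgroup G) = c at *
    interval_cases c <;> omega
  · have : Fact (Nat.Prime 2) := ⟨Nat.prime_two⟩
    obtain ⟨V, hVH, hV⟩ := exists_sub (H := H) 2 2 (by rw [hH]; norm_num)
    norm_num at hV
    have hn := D.exc_V hq hx hH hVH hV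
    obtain ⟨c, hcK, S, hSK, pS, s1, s2⟩ := sylow_conj 2 (hVH.trans hHK) ((conj_mono hVH g).trans hgK)
      (IsPGroup.of_card (n := 2) (by rw [hV]; rfl)) (IsPGroup.of_card (n := 2) (by rw [card_conj, hV]; rfl))
    have hS : Nat.card S ≤ 4 := by
      obtain ⟨n, hn⟩ := pS.exists_card_eq
      have d := Subgroup.card_dvd_of_le hSK
      rw [hn, hK'] at d
      rw [hn]
      by_contra h
      have h3 : 3 ≤ n := by
        by_contra h3
        have : n = 0 ∨ n = 1 ∨ n = 2 := by omega
        rcases this with rfl | rfl | rfl <;> omega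
      have := (pow_dvd_pow 2 h3).trans d
      omega
    have e1 := eq_of_le_card s1 (by omega)
    have e2 := eq_of_le_card s2 (by rw [card_conj, card_conj]; omega)
    rw [conj_conj, ← e1] at e2
    refine ⟨c, hcK, 1, one_mem _, ?_⟩
    rw [conj_one]
    have l1 : H ≤ K ⊓ M V := le_inf hHK hn
    have l2 : H.conjugate (g * c) ≤ K ⊓ M V := by
      refine le_inf ?_ ?_
      · rw [← conj_conj]; exact conj_le_of_mem hgK hcK
      · intro y hy
        rw [mem_conj] at hy
        have h1 : g * c ∈ M V := e2
        have h2 := mul_mem (mul_mem (inv_mem h1) (hn hy)) h1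
        simpa [mul_assoc] using h2
    have d1 := Subgroup.card_dvd_of_le l1
    have d2 := Subgroup.card_dvd_of_le (inf_le_left : K ⊓ M V ≤ K)
    rw [hH] at d1
    rw [hK'] at d2
    have : Nat.card (K ⊓ M V : Subgroup G) = 12 ∨ Nat.card (K ⊓ M V : Subgroup G) = 60 := by
      obtain ⟨a, ha⟩ := d1
      rw [ha] at d2 ⊢
      have := Nat.le_of_dvd (by norm_num) d2
      have : a ≤ 5 := by omega
      interval_cases a <;> omega
    rcases this with h | h
    · exact (eq_of_le_card l1 (by omega)).trans (eq_of_le_card l2 (by rw [card_conj]; omega)).symm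
    · exfalso
      have e := eq_of_le_card (inf_le_left : K ⊓ M V ≤ K) (by omega)
      exact D.exc_sixty hqK hKx hK' (hVH.trans hHK) hV (inf_eq_left.1 e)

theorem main [Finite X] (D : PoleData G X q k) (H : Subgroup G) :
    ¬ IsPronormal H ↔ ∃ j : ℕ, 1 ≤ j ∧ j ≤ k - 2 ∧ Nonempty (H ≃* DihedralGroup (2 ^ (j - 1))) := by
  constructor
  swap
  · rintro ⟨j, h1, h2, ⟨e⟩⟩
    exact D.not_pron h1 h2 e
  intro hnp
  have hk := D.hk
  have : Fact (Nat.Prime 2) := ⟨Nat.prime_two⟩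
  have hbot : H ≠ ⊥ := by
    rintro rfl
    apply hnp
    intro g
    exact ⟨1, one_mem _, by ext; simp [mem_conj]⟩
  have hq : ¬ q ∣ Nat.card H := fun h => hnp (D.pron_q h)
  have hx : ∃ x, H ≤ D.N x := by
    by_contra h
    push Not at h
    exact hnp (D.pron_exc hq h hbot)
  -- `H` is a 2-group
  have h2 : IsPGroup 2 H := by
    obtain ⟨x, hx⟩ := hx
    have key : ∃ n, Nat.card (H ⊓ stabilizer G x : Subgroup G) = 2 ^ n := by
      rcases D.cardstab x with ho | hd
      · by_cases hA : H ⊓ stabilizer G x = ⊥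
        · exact ⟨0, by rw [hA, Subgroup.card_bot, pow_zero]⟩
        · exact absurd (D.pron_odd hx ho hA) hnp
      · have := (Subgroup.card_dvd_of_le (inf_le_right : H ⊓ stabilizer G x ≤ stabilizer G x)).trans hd
        obtain ⟨n, -, hn⟩ := (Nat.dvd_prime_pow Nat.prime_two).1 this
        exact ⟨n, hn⟩
    obtain ⟨n, hn⟩ := key
    rcases D.exists_rev_or hx with h | ⟨s, hs, hsx⟩
    · rw [inf_eq_left.2 h] at hn
      exact IsPGroup.of_card hn
    · exact IsPGroup.of_card (n := n + 1) (by rw [D.card_inf hx hs hsx, hn, pow_succ'])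
  obtain ⟨j, hj⟩ := h2.exists_card_eq
  have hj1 : 1 ≤ j := by
    by_contra h
    have : j = 0 := by omega
    rw [this, pow_zero] at hj
    exact hbot (Subgroup.card_eq_one.1 hj)
  have hjk : j ≤ k - 2 := by
    have h1 : j ≤ k := by
      by_contra h
      exact D.two_pow_not_dvd ((pow_dvd_pow 2 (by omega : k + 1 ≤ j)).trans (hj ▸ Subgroup.card_subgroup_dvd_card H))
    by_contra h
    apply hnp
    apply D.pron_big2
    have : j = k ∨ j = k - 1 := by omega
    rcases this with e | e
    · left; rw [hj, e]
    · right; rw [hj, e]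
  refine ⟨j, hj1, hjk, ?_⟩
  have h2j : 2 ^ j = 2 * 2 ^ (j - 1) := by rw [← pow_succ']; congr 1; omega
  obtain ⟨x, hxN, -, -, -, -⟩ := D.two_group h2
  rcases D.exists_rev_or hxN with h | ⟨s, hs, hsx⟩
  · have hcyc : IsCyclic H := by
      have := D.cyc x
      exact isCyclic_of_injective (Subgroup.inclusion h) (Subgroup.inclusion_injective _)
    have hle : Nat.card H ≤ 2 := by
      by_contra h
      exact hnp (D.pron_cyc2 h2 hcyc (by omega))
    have hj' : j = 1 := by
      by_contra hne
      have : 2 ^ 2 ≤ 2 ^ j := Nat.pow_le_pow_right (by norm_num) (by omega)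
      omega
    subst hj'
    have hcd : Nat.card (DihedralGroup (2 ^ (1 - 1))) = 2 := by
      rw [DihedralGroup.nat_card]; rfl
    exact ⟨mulEquivOfPrimeCardEq (p := 2) (by rw [hj]; rfl) hcd⟩
  · have := D.card_inf hxN hs hsx
    have e : Nat.card (H ⊓ stabilizer G x : Subgroup G) = 2 ^ (j - 1) := by omega
    have := D.dihedral_iso hxN hs hsx
    rwa [e] at this

end PoleData
end PronPSL

namespace PronPSL
open Matrix

abbrev Mat (F : Type*) := Matrix (Fin 2) (Fin 2) F
abbrev SL2 (F : Type*) [Field F] := Matrix.SpecialLinearGroup (Fin 2) F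
abbrev PSL2 (F : Type*) [Field F] := Matrix.ProjectiveSpecialLinearGroup (Fin 2) F

section mat
variable {F : Type*} [Field F]

theorem mat_ch (A : Mat F) : A * A = A.trace • A - A.det • (1 : Mat F) := by
  rw [Matrix.trace_fin_two, Matrix.det_fin_two]
  ext i j
  fin_cases i <;> fin_cases j <;> simp [Matrix.mul_apply, Fin.sum_univ_two] <;> ring

theorem mat_sq {v : Mat F} (h : v.trace = 0) : v * v = (-v.det) • (1 : Mat F) := by
  rw [mat_ch, h]; simp

theorem mat_adj (A : Mat F) : A.adjugate = A.trace • (1 : Mat F) - A := by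
  rw [Matrix.trace_fin_two, Matrix.adjugate_fin_two]
  ext i j
  fin_cases i <;> fin_cases j <;> simp

theorem mat_det_add (c : F) (v : Mat F) : (c • (1 : Mat F) + v).det = c ^ 2 + c * v.trace + v.det := by
  rw [Matrix.trace_fin_two, Matrix.det_fin_two, Matrix.det_fin_two]
  simp; ring

theorem mat_trace_smul_one (c : F) : (c • (1 : Mat F)).trace = 2 * c := by
  rw [Matrix.trace_fin_two]; simp; ring

theorem mat_det_smul (c : F) (v : Mat F) : (c • v).det = c ^ 2 * v.det := by
  rw [Matrix.det_smul]; simp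

theorem mat_smul_one_ne {c : F} (hc : c ≠ 0) : c • (1 : Mat F) ≠ 0 := by
  intro h
  have := congrFun (congrFun h 0) 0
  simp at this
  exact hc this

theorem comm_traceless {x y : Mat F} (hx : x.trace = 0) (hy : y.trace = 0) (hne : x ≠ 0)
    (hc : x * y = y * x) (h2 : (2 : F) ≠ 0) : ∃ μ : F, y = μ • x := by
  rw [Matrix.trace_fin_two] at hx hy
  have e00 := congrFun (congrFun hc 0) 0
  have e01 := congrFun (congrFun hc 0) 1
  have e10 := congrFun (congrFun hc 1) 0
  simp only [Matrix.mul_apply, Fin.sum_univ_two] at e00 e01 e10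
  have hx1 : x 1 1 = - x 0 0 := by linear_combination hx
  have hy1 : y 1 1 = - y 0 0 := by linear_combination hy
  rw [hx1, hy1] at e01 e10
  have f00 : x 0 1 * y 1 0 = y 0 1 * x 1 0 := by linear_combination e00
  have f01 : x 0 0 * y 0 1 = y 0 0 * x 0 1 := by
    apply mul_left_cancel₀ h2; linear_combination e01
  have f10 : x 0 0 * y 1 0 = y 0 0 * x 1 0 := by
    apply mul_left_cancel₀ h2; linear_combination -e10
  have fin : ∀ μ : F, y 0 0 = μ * x 0 0 → y 0 1 = μ * x 0 1 → y 1 0 = μ * x 1 0 → y = μ • x := by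
    intro μ h1 h2 h3
    ext i j
    fin_cases i <;> fin_cases j <;> simp [hx1, hy1, h1, h2, h3]
  by_cases ha : x 0 0 = 0
  · by_cases hb : x 0 1 = 0
    · have hcc : x 1 0 ≠ 0 := by
        intro hcc
        apply hne
        ext i j
        fin_cases i <;> fin_cases j <;> simp [ha, hb, hcc, hx1]
      refine ⟨y 1 0 / x 1 0, fin _ ?_ ?_ ?_⟩ <;> rw [div_mul_eq_mul_div, eq_div_iff hcc]
      · linear_combination -f10
      · linear_combination -f00
    · refine ⟨y 0 1 / x 0 1, fin _ ?_ ?_ ?_⟩ <;> rw [div_mul_eq_mul_div, eq_div_iff hb]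
      · linear_combination -f01
      · linear_combination f00
  · refine ⟨y 0 0 / x 0 0, fin _ ?_ ?_ ?_⟩ <;> rw [div_mul_eq_mul_div, eq_div_iff ha]
    · linear_combination f01
    · linear_combination f10

/-- coercion as a homomorphism -/
theorem sl_mul_adj (A : SL2 F) : (A : Mat F) * (A : Mat F).adjugate = 1 := by
  rw [Matrix.mul_adjugate, A.2, one_smul]

theorem sl_adj_mul (A : SL2 F) : (A : Mat F).adjugate * (A : Mat F) = 1 := by
  rw [Matrix.adjugate_mul, A.2, one_smul]

/-- the projection -/
def pr (F : Type*) [Field F] : SL2 F →* PSL2 F := QuotientGroup.mk' _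

theorem pr_surj (g : PSL2 F) : ∃ A, pr F A = g := QuotientGroup.mk'_surjective _ g

theorem mem_center_iff' {A : SL2 F} : A ∈ Subgroup.center (SL2 F) ↔
    ∃ c : F, c ^ 2 = 1 ∧ (A : Mat F) = c • (1 : Mat F) := by
  rw [Matrix.SpecialLinearGroup.mem_center_iff]
  constructor
  · rintro ⟨r, hr, h⟩
    refine ⟨r, by simpa using hr, ?_⟩
    rw [← h, Matrix.scalar_apply, ← Matrix.smul_one_eq_diagonal]
  · rintro ⟨r, hr, h⟩
    refine ⟨r, by simpa using hr, ?_⟩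
    rw [h, Matrix.scalar_apply, ← Matrix.smul_one_eq_diagonal]

theorem pr_eq_one {A : SL2 F} : pr F A = 1 ↔ ∃ c : F, c ^ 2 = 1 ∧ (A : Mat F) = c • (1 : Mat F) := by
  rw [← mem_center_iff']
  exact QuotientGroup.eq_one_iff A

theorem pr_eq {A B : SL2 F} : pr F A = pr F B ↔ ∃ c : F, c ^ 2 = 1 ∧ (A : Mat F) = c • (B : Mat F) := by
  rw [← mul_inv_eq_one, ← map_inv, ← map_mul, pr_eq_one]
  refine exists_congr fun c => and_congr_right fun _ => ?_
  rw [Matrix.SpecialLinearGroup.coe_mul, Matrix.SpecialLinearGroup.coe_inv]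
  constructor
  · intro h
    have := congrArg (· * (B : Mat F)) h
    simpa [mul_assoc, sl_adj_mul] using this
  · intro h
    rw [h, Matrix.smul_mul, sl_mul_adj]

/-- the poles -/
abbrev Pole (F : Type*) [Field F] (ν : F) := {v : Mat F // v.trace = 0 ∧ (v.det = 1 ∨ v.det = ν)}

instance (ν : F) [Finite F] : Finite (Pole F ν) := by
  infer_instance

variable {ν : F}

instance poleActSL : MulAction (SL2 F) (Pole F ν) where
  smul A v := ⟨(A : Mat F) * v.1 * (A : Mat F).adjugate, by
    rw [Matrix.trace_mul_comm, ← mul_assoc, sl_adj_mul, one_mul]; exact v.2.1, by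
    rw [Matrix.det_mul, Matrix.det_mul, mul_right_comm, ← Matrix.det_mul, sl_mul_adj, Matrix.det_one, one_mul]
    exact v.2.2⟩
  one_smul v := Subtype.ext (by
    change ((1 : SL2 F) : Mat F) * v.1 * ((1 : SL2 F) : Mat F).adjugate = v.1
    simp)
  mul_smul A B v := Subtype.ext (by
    change ((A * B : SL2 F) : Mat F) * v.1 * ((A * B : SL2 F) : Mat F).adjugate =
      (A : Mat F) * ((B : Mat F) * v.1 * (B : Mat F).adjugate) * (A : Mat F).adjugate
    rw [Matrix.SpecialLinearGroup.coe_mul, Matrix.adjugate_mul_distrib]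
    simp only [mul_assoc])

theorem sl_smul_val (A : SL2 F) (v : Pole F ν) : (A • v).1 = (A : Mat F) * v.1 * (A : Mat F).adjugate := rfl

theorem sl_smul_eq {A : SL2 F} {v w : Pole F ν} : A • v = w ↔ (A : Mat F) * v.1 = w.1 * (A : Mat F) := by
  constructor
  · rintro rfl
    rw [sl_smul_val, mul_assoc, sl_adj_mul, mul_one]
  · intro h
    apply Subtype.ext
    rw [sl_smul_val, h, mul_assoc, sl_mul_adj, mul_one]

/-- the action hom -/
def poleHom (F : Type*) [Field F] (ν : F) : PSL2 F →* Equiv.Perm (Pole F ν) :=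
  QuotientGroup.lift _ (MulAction.toPermHom (SL2 F) (Pole F ν)) (by
    intro A hA
    obtain ⟨c, hc, e⟩ := mem_center_iff'.1 hA
    ext v : 1
    change A • v = v
    rw [sl_smul_eq, e]
    simp)

instance poleAct : MulAction (PSL2 F) (Pole F ν) := MulAction.compHom _ (poleHom F ν)

theorem pr_smul (A : SL2 F) (v : Pole F ν) : pr F A • v = A • v := rfl

theorem pr_smul_eq {A : SL2 F} {v w : Pole F ν} : pr F A • v = w ↔ (A : Mat F) * v.1 = w.1 * (A : Mat F) := by
  rw [pr_smul, sl_smul_eq]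

/-- negation of poles -/
def pneg (v : Pole F ν) : Pole F ν := ⟨-v.1, by rw [Matrix.trace_neg, v.2.1, neg_zero], by
  rw [Matrix.det_neg]; simpa using v.2.2⟩

theorem pole_det_ne (hν : ν ≠ 0) (v : Pole F ν) : v.1.det ≠ 0 := by
  rcases v.2.2 with h | h <;> rw [h]
  · exact one_ne_zero
  · exact hν

theorem pole_ne (hν : ν ≠ 0) (v : Pole F ν) : v.1 ≠ 0 := by
  intro h
  apply pole_det_ne hν v
  rw [h]; simp

theorem pole_rev (h2 : (2 : F) ≠ 0) (hν : ν ≠ 0) (g : PSL2 F) (v : Pole F ν) (h : g • v = pneg v) : g * g = 1 := by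
  obtain ⟨A, rfl⟩ := pr_surj g
  rw [pr_smul_eq] at h
  change (A : Mat F) * v.1 = -v.1 * (A : Mat F) at h
  have hs := mat_sq v.2.1
  have hd := pole_det_ne hν v
  have ht : (A : Mat F).trace = 0 := by
    have h1 : (A : Mat F) * (v.1 * v.1) = -(v.1 * (A : Mat F) * v.1) := by
      rw [← mul_assoc, h]; simp
    have h3 := congrArg Matrix.trace h1
    rw [Matrix.trace_neg, Matrix.trace_mul_comm (v.1 * (A : Mat F)), ← mul_assoc v.1 v.1, hs] at h3
    simp only [Matrix.mul_smul, Matrix.smul_mul, mul_one, one_mul, Matrix.trace_smul, smul_eq_mul] at h3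
    have : 2 * v.1.det * (A : Mat F).trace = 0 := by linear_combination -h3
    simpa [h2, hd] using this
  rw [← map_mul, pr_eq_one]
  refine ⟨-1, by ring, ?_⟩
  rw [Matrix.SpecialLinearGroup.coe_mul, mat_sq ht, A.2]

end mat
end PronPSL

namespace PronPSL
open Matrix

section fin
variable {F : Type*} [Field F] {ν : F}

theorem sl_decomp (h2 : (2 : F) ≠ 0) (A : SL2 F) : ∃ (c : F) (n : Mat F), (A : Mat F) = c • (1 : Mat F) + n ∧ n.trace = 0 ∧
    c ^ 2 + n.det = 1 := by
  have ht : ((A : Mat F) - ((A : Mat F).trace / 2) • (1 : Mat F)).trace = 0 := by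
    rw [Matrix.trace_sub, mat_trace_smul_one]; field_simp; ring
  refine ⟨(A : Mat F).trace / 2, (A : Mat F) - ((A : Mat F).trace / 2) • (1 : Mat F), by abel, ht, ?_⟩
  have h := mat_det_add ((A : Mat F).trace / 2) ((A : Mat F) - ((A : Mat F).trace / 2) • (1 : Mat F))
  rw [ht, add_sub_cancel, A.2] at h
  linear_combination -h

theorem pole_decomp (h2 : (2 : F) ≠ 0) (hν : ν ≠ 0) {A : SL2 F} {v : Pole F ν} (h : (A : Mat F) * v.1 = v.1 * (A : Mat F)) :
    ∃ a b : F, (A : Mat F) = a • (1 : Mat F) + b • v.1 ∧ a ^ 2 + b ^ 2 * v.1.det = 1 := by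
  obtain ⟨c, n, e, ht, hd⟩ := sl_decomp h2 A
  obtain ⟨b, hb⟩ := comm_traceless v.2.1 ht (pole_ne hν v) (by
    rw [e, add_mul, mul_add] at h
    simpa using h.symm) h2
  refine ⟨c, b, by rw [e, hb], ?_⟩
  rw [hb, mat_det_smul] at hd
  exact hd

theorem ab_mul (v : Mat F) (ht : v.trace = 0) (a b a' b' : F) : (a • (1 : Mat F) + b • v) * (a' • (1 : Mat F) + b' • v) =
    (a * a' - b * b' * v.det) • (1 : Mat F) + (a * b' + b * a') • v := by
  have := mat_sq ht
  simp only [add_mul, mul_add, Matrix.smul_mul, Matrix.mul_smul, this, one_mul, mul_one, smul_smul]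
  module

theorem ab_trace (v : Mat F) (ht : v.trace = 0) (a b : F) : (a • (1 : Mat F) + b • v).trace = 2 * a := by
  rw [Matrix.trace_add, mat_trace_smul_one, Matrix.trace_smul, ht]; simp

theorem ab_trace_mul (v : Mat F) (ht : v.trace = 0) (a b : F) :
    ((a • (1 : Mat F) + b • v) * v).trace = -(2 * b * v.det) := by
  rw [add_mul, Matrix.smul_mul, Matrix.smul_mul, mat_sq ht, one_mul, Matrix.trace_add, Matrix.trace_smul, ht,
    Matrix.trace_smul, mat_trace_smul_one]
  simp; ring

/-- centralizer of a pole -/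
def cent (v : Pole F ν) : Subgroup (SL2 F) := MulAction.stabilizer (SL2 F) v

theorem mem_cent {v : Pole F ν} {A : SL2 F} : A ∈ cent v ↔ (A : Mat F) * v.1 = v.1 * (A : Mat F) := sl_smul_eq

theorem cent_cyclic [Finite F] (h2 : (2 : F) ≠ 0) (hν : ν ≠ 0) (v : Pole F ν) : IsCyclic (cent v) := by
  classical
  obtain ⟨s, hs⟩ := IsAlgClosed.exists_pow_nat_eq (algebraMap F (AlgebraicClosure F) (-v.1.det)) (n := 2) (by norm_num)
  set i := algebraMap F (AlgebraicClosure F) with hi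
  have hd := pole_det_ne hν v
  let f0 : SL2 F → AlgebraicClosure F := fun A =>
    i ((A : Mat F).trace / 2) + i (-((A : Mat F) * v.1).trace / (2 * v.1.det)) * s
  have hf0 : ∀ (A : SL2 F) (a b : F), (A : Mat F) = a • (1 : Mat F) + b • v.1 → f0 A = i a + i b * s := by
    intro A a b h
    change i ((A : Mat F).trace / 2) + i (-((A : Mat F) * v.1).trace / (2 * v.1.det)) * s = _
    rw [h, ab_trace _ v.2.1, ab_trace_mul _ v.2.1]
    congr 2
    · field_simp
    · congr 1; field_simp
  let f : cent v →* AlgebraicClosure F :=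
    { toFun := fun A => f0 A
      map_one' := by
        rw [hf0 _ 1 0 (by simp)]; simp
      map_mul' := by
        intro A B
        obtain ⟨a, b, h, -⟩ := pole_decomp h2 hν (mem_cent.1 A.2)
        obtain ⟨a', b', h', -⟩ := pole_decomp h2 hν (mem_cent.1 B.2)
        rw [hf0 _ a b h, hf0 _ a' b' h', hf0 ((A * B : cent v) : SL2 F) (a * a' - b * b' * v.1.det) (a * b' + b * a')]
        · have hs' : s * s = - i (v.1.det) := by rw [← pow_two, hs, map_neg]
          simp only [map_sub, map_mul, map_add]
          linear_combination (-i b * i b') * hs'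
        · rw [Subgroup.coe_mul, Matrix.SpecialLinearGroup.coe_mul, h, h', ab_mul _ v.2.1] }
  have : Finite (cent v) := inferInstance
  refine isCyclic_of_injective_ringHom f ?_
  rw [injective_iff_map_eq_one]
  intro A hA
  change f0 A = 1 at hA
  obtain ⟨a, b, h, hab⟩ := pole_decomp h2 hν (mem_cent.1 A.2)
  rw [hf0 _ a b h] at hA
  have e1 : (i a + i b * s) * (i a - i b * s) = 1 := by
    have := congrArg i hab
    simp only [map_add, map_mul, map_pow, map_one] at this
    rw [map_neg] at hs
    linear_combination this - (i b) ^ 2 * hs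
  rw [hA, one_mul] at e1
  have i2 : (2 : AlgebraicClosure F) ≠ 0 := by
    rw [← map_ofNat i 2]; exact (map_ne_zero i).2 h2
  have ha : i a = i 1 := by
    apply mul_left_cancel₀ i2; rw [map_one]; linear_combination hA + e1
  have ha' : a = 1 := i.injective ha
  have hb : b = 0 := by
    rw [ha'] at hab
    have : b ^ 2 * v.1.det = 0 := by linear_combination hab
    simpa [hd] using this
  apply Subtype.ext
  apply Subtype.ext
  rw [h, ha', hb]
  simp

theorem stab_mk {v : Pole F ν} {g : PSL2 F} (hg : g ∈ MulAction.stabilizer (PSL2 F) v) :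
    ∃ A ∈ cent v, pr F A = g := by
  obtain ⟨A, rfl⟩ := pr_surj g
  exact ⟨A, hg, rfl⟩

theorem stab_cyclic [Finite F] (h2 : (2 : F) ≠ 0) (hν : ν ≠ 0) (v : Pole F ν) :
    IsCyclic (MulAction.stabilizer (PSL2 F) v) := by
  have := cent_cyclic h2 hν v
  let φ : cent v →* MulAction.stabilizer (PSL2 F) v :=
    ((pr F).comp (cent v).subtype).codRestrict _ (fun A => A.2)
  refine isCyclic_of_surjective φ ?_
  rintro ⟨g, hg⟩
  obtain ⟨A, hA, rfl⟩ := stab_mk hg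
  exact ⟨⟨A, hA⟩, rfl⟩

theorem sq_one (h2 : (2 : F) ≠ 0) {B : SL2 F} (h : B * B = 1) : pr F B = 1 := by
  have h' := congrArg (fun C : SL2 F => (C : Mat F)) h
  simp only [Matrix.SpecialLinearGroup.coe_mul, Matrix.SpecialLinearGroup.coe_one] at h'
  rw [mat_ch, B.2, one_smul, sub_eq_iff_eq_add] at h'
  have h3 : (B : Mat F).trace • (B : Mat F) = (2 : F) • (1 : Mat F) := by
    rw [h', two_smul]
  set t := (B : Mat F).trace
  have ht : t ≠ 0 := by
    intro e
    rw [e, zero_smul] at h3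
    exact mat_smul_one_ne h2 h3.symm
  have h4 : (B : Mat F) = (t⁻¹ * 2) • (1 : Mat F) := by
    rw [mul_smul, ← h3, smul_smul, inv_mul_cancel₀ ht, one_smul]
  refine pr_eq_one.2 ⟨t⁻¹ * 2, ?_, h4⟩
  have h5 := congrArg Matrix.det h4
  rw [mat_det_smul, B.2, Matrix.det_one] at h5
  linear_combination -h5

variable [Fintype F] {q : ℕ} [Fact q.Prime] [CharP F q]

theorem pow_q (hF : Fintype.card F = q) (a : F) : a ^ q = a := by
  rw [← hF]; exact FiniteField.pow_card a

theorem stab_pow (hF : Fintype.card F = q) (hq2 : q ≠ 2) (hν : ν ≠ 0) (v : Pole F ν) :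
    ∃ n, (n = (q - 1) / 2 ∨ n = (q + 1) / 2) ∧ ∀ g ∈ MulAction.stabilizer (PSL2 F) v, g ^ n = 1 := by
  have hrc : ringChar F ≠ 2 := by rw [ringChar.eq F q]; exact hq2
  have h2 : (2 : F) ≠ 0 := Ring.two_ne_zero hrc
  have hqo : q % 2 = 1 := by
    have := (Fact.out : q.Prime).eq_two_or_odd; omega
  have hvq : v.1 ^ q = ((-v.1.det) ^ (q / 2)) • v.1 := by
    conv_lhs => rw [← Nat.div_add_mod q 2, hqo, pow_succ, pow_mul, pow_two, mat_sq v.2.1, smul_pow, one_pow,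
      Matrix.smul_mul, one_mul]
  have hpow : ∀ a b : F, (a • (1 : Mat F) + b • v.1) ^ q = a • (1 : Mat F) + (b * (-v.1.det) ^ (q / 2)) • v.1 := by
    intro a b
    rw [add_pow_char_of_commute _ (by
      apply Commute.smul_left; apply Commute.smul_right; exact Commute.one_left _), smul_pow, smul_pow, pow_q hF,
      pow_q hF, one_pow, hvq, smul_smul]
  have hdich := FiniteField.pow_dichotomy hrc (neg_ne_zero.2 (pole_det_ne hν v))
  rw [hF] at hdich
  have hq1 := (Fact.out : q.Prime).one_lt
  rcases hdich with hε | hε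
  · refine ⟨(q - 1) / 2, Or.inl rfl, fun g hg => ?_⟩
    obtain ⟨A, hA, rfl⟩ := stab_mk hg
    rw [← map_pow]
    apply sq_one h2
    rw [← pow_add, ← two_mul, Nat.mul_div_cancel' (by omega)]
    obtain ⟨a, b, h, -⟩ := pole_decomp h2 hν (mem_cent.1 hA)
    have : A ^ q = A := by
      apply Subtype.ext
      rw [Matrix.SpecialLinearGroup.coe_pow, h, hpow, hε, mul_one]
    rw [show q = (q - 1) + 1 by omega, pow_succ, mul_eq_right] at this
    exact this
  · refine ⟨(q + 1) / 2, Or.inr rfl, fun g hg => ?_⟩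
    obtain ⟨A, hA, rfl⟩ := stab_mk hg
    rw [← map_pow]
    apply sq_one h2
    rw [← pow_add, ← two_mul, Nat.mul_div_cancel' (by omega)]
    obtain ⟨a, b, h, hab⟩ := pole_decomp h2 hν (mem_cent.1 hA)
    apply Subtype.ext
    rw [Matrix.SpecialLinearGroup.coe_pow, h, pow_succ, hpow, hε, ab_mul _ v.2.1, Matrix.SpecialLinearGroup.coe_one]
    rw [show a * a - b * -1 * b * v.1.det = 1 by linear_combination hab, show a * b + b * -1 * a = 0 by ring]
    simp

theorem stab_card (hF : Fintype.card F = q) (hq2 : q ≠ 2) (hν : ν ≠ 0) (v : Pole F ν) :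
    Nat.card (MulAction.stabilizer (PSL2 F) v) ∣ (q - 1) / 2 ∨
    Nat.card (MulAction.stabilizer (PSL2 F) v) ∣ (q + 1) / 2 := by
  have hrc : ringChar F ≠ 2 := by rw [ringChar.eq F q]; exact hq2
  have := stab_cyclic (Ring.two_ne_zero hrc) hν v
  obtain ⟨n, hn, h⟩ := stab_pow hF hq2 hν v
  have h3 : Nat.card (MulAction.stabilizer (PSL2 F) v) ∣ n := by
    rw [← IsCyclic.exponent_eq_card]
    apply Monoid.exponent_dvd_of_forall_pow_eq_one
    intro g
    exact Subtype.ext (h g g.2)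
  rcases hn with rfl | rfl
  · exact Or.inl h3
  · exact Or.inr h3

theorem nil_order {A : SL2 F} {c : F} {n : Mat F} (h : (A : Mat F) = c • (1 : Mat F) + n)
    (ht : n.trace = 0) (hd : n.det = 0) (hc : c ^ 2 = 1) : (pr F A) ^ q = 1 := by
  rw [← map_pow, pr_eq_one]
  refine ⟨c ^ q, by rw [← pow_mul, mul_comm, pow_mul, hc, one_pow], ?_⟩
  rw [Matrix.SpecialLinearGroup.coe_pow, h, add_pow_char_of_commute _ (by
    apply Commute.smul_left; exact Commute.one_left _), smul_pow, one_pow]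
  have hq1 := (Fact.out : q.Prime).two_le
  have : n ^ q = 0 := by
    rw [show q = 2 + (q - 2) by omega, pow_add, pow_two, mat_sq ht, hd]; simp
  rw [this, add_zero]

theorem scale (hq2 : q ≠ 2) (hν : ¬ IsSquare ν) {d : F} (hd : d ≠ 0) : ∃ l : F, l ≠ 0 ∧ (l ^ 2 * d = 1 ∨ l ^ 2 * d = ν) := by
  have hrc : ringChar F ≠ 2 := by rw [ringChar.eq F q]; exact hq2
  have hν0 : ν ≠ 0 := by rintro rfl; exact hν (IsSquare.zero)
  by_cases h : IsSquare d
  · obtain ⟨r, rfl⟩ := h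
    have : r ≠ 0 := by rintro rfl; simp at hd
    exact ⟨r⁻¹, inv_ne_zero this, Or.inl (by field_simp)⟩
  · have h1 := (FiniteField.pow_dichotomy hrc hd).resolve_left (fun e => h ((FiniteField.isSquare_iff hrc hd).2 e))
    have h2 := (FiniteField.pow_dichotomy hrc hν0).resolve_left (fun e => hν ((FiniteField.isSquare_iff hrc hν0).2 e))
    have h3 : IsSquare (ν / d) := by
      rw [FiniteField.isSquare_iff hrc (div_ne_zero hν0 hd), div_pow, h1, h2]; simp
    obtain ⟨r, hr⟩ := h3
    refine ⟨r, ?_, Or.inr ?_⟩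
    · rintro rfl
      rw [mul_zero, div_eq_zero_iff] at hr
      exact hr.elim hν0 hd
    · rw [pow_two, ← hr]; field_simp

theorem pole_same (hν : ¬ IsSquare ν) {x y : Pole F ν} {μ : F} (h : y.1 = μ • x.1) : y = x ∨ y = pneg x := by
  have hν0 : ν ≠ 0 := by rintro rfl; exact hν (IsSquare.zero)
  have hd := congrArg Matrix.det h
  rw [mat_det_smul] at hd
  have : μ ^ 2 = 1 := by
    rcases x.2.2 with hx | hx <;> rcases y.2.2 with hy | hy <;> rw [hx, hy] at hd
    · linear_combination -hd
    · exact absurd ⟨μ, by rw [hd]; ring⟩ hν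
    · refine absurd ⟨μ⁻¹, ?_⟩ hν
      have hμ : μ ≠ 0 := by rintro rfl; simp at hd
      field_simp
      linear_combination -hd
    · have : (μ ^ 2 - 1) * ν = 0 := by linear_combination -hd
      have := (mul_eq_zero.1 this).resolve_right hν0
      linear_combination this
  rcases mul_self_eq_one_iff.1 ((pow_two μ).symm.trans this) with e | e
  · left; exact Subtype.ext (by rw [h, e, one_smul])
  · right; exact Subtype.ext (by rw [h, e, neg_smul, one_smul]; rfl)

theorem pole_fix (hq2 : q ≠ 2) (hν : ¬ IsSquare ν) (g : PSL2 F) (hg : g ≠ 1) (ho : orderOf g ≠ q) :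
    ∃ x : Pole F ν, ∀ y, g • y = y ↔ (y = x ∨ y = pneg x) := by
  have hrc : ringChar F ≠ 2 := by rw [ringChar.eq F q]; exact hq2
  have h2 : (2 : F) ≠ 0 := Ring.two_ne_zero hrc
  have hν0 : ν ≠ 0 := by rintro rfl; exact hν (IsSquare.zero)
  obtain ⟨A, rfl⟩ := pr_surj g
  obtain ⟨c, n, e, ht, hd⟩ := sl_decomp h2 A
  have hd0 : n.det ≠ 0 := by
    intro h0
    rw [h0, add_zero] at hd
    exact ho (orderOf_eq_prime (nil_order e ht h0 hd) hg)
  obtain ⟨l, hl, hl2⟩ := scale hq2 hν hd0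
  let x : Pole F ν := ⟨l • n, by rw [Matrix.trace_smul, ht, smul_zero], by rw [mat_det_smul]; exact hl2⟩
  have hAx : pr F A • x = x := by
    rw [pr_smul_eq, e]
    change _ * (l • n) = (l • n) * _
    simp [add_mul, mul_add]
    exact smul_comm _ _ _
  refine ⟨x, fun y => ⟨fun hy => ?_, ?_⟩⟩
  · rw [pr_smul_eq, e, add_mul, mul_add] at hy
    obtain ⟨μ, hμ⟩ := comm_traceless (x := x.1) (y := y.1) x.2.1 y.2.1 (pole_ne hν0 x) (by
      change (l • n) * y.1 = y.1 * (l • n)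
      rw [Matrix.smul_mul, Matrix.mul_smul]
      congr 1
      simpa using hy) h2
    exact pole_same hν hμ
  · rintro (rfl | rfl)
    · exact hAx
    · rw [pr_smul_eq] at hAx ⊢
      change _ * (-x.1) = (-x.1) * _
      rw [mul_neg, neg_mul, hAx]

end fin
end PronPSL

namespace PronPSL
open Matrix

section fin
variable {F : Type*} [Field F]

theorem two_sq_one {c : F} (h : c ^ 2 = 1) : c = 1 ∨ c = -1 :=
  mul_self_eq_one_iff.1 ((pow_two c).symm.trans h)

theorem sl_ne_zero (A : SL2 F) : (A : Mat F) ≠ 0 := by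
  intro h
  have := A.2
  rw [h] at this
  simp at this

theorem inv_mat (h2 : (2 : F) ≠ 0) {J : SL2 F} (h : pr F J * pr F J = 1) (h1 : pr F J ≠ 1) :
    (J : Mat F).trace = 0 ∧ (J : Mat F) * J = -1 := by
  rw [← map_mul, pr_eq_one] at h
  obtain ⟨c, hc, e⟩ := h
  rw [Matrix.SpecialLinearGroup.coe_mul] at e
  rcases two_sq_one hc with rfl | rfl
  · exfalso
    apply h1
    apply sq_one h2
    apply Subtype.ext
    rw [Matrix.SpecialLinearGroup.coe_mul, e, one_smul, Matrix.SpecialLinearGroup.coe_one]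
  · rw [neg_smul, one_smul] at e
    refine ⟨?_, e⟩
    rw [mat_ch, J.2, one_smul, sub_eq_iff_eq_add, neg_add_cancel, smul_eq_zero] at e
    exact e.resolve_right (sl_ne_zero J)

theorem invol (h2 : (2 : F) ≠ 0) (s t : PSL2 F) (hs : s * s = 1) (ht : t * t = 1) (hs1 : s ≠ 1) (ht1 : t ≠ 1)
    (hne : s ≠ t) (hc : s * t = t * s) : ∃ g, g⁻¹ * s * g = t := by
  obtain ⟨J, rfl⟩ := pr_surj s
  obtain ⟨L, rfl⟩ := pr_surj t
  obtain ⟨hJ, hJ2⟩ := inv_mat h2 hs hs1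
  obtain ⟨hL, hL2⟩ := inv_mat h2 ht ht1
  rw [← map_mul, ← map_mul, pr_eq] at hc
  obtain ⟨c, hc, e⟩ := hc
  rw [Matrix.SpecialLinearGroup.coe_mul, Matrix.SpecialLinearGroup.coe_mul] at e
  rcases two_sq_one hc with rfl | rfl
  · exfalso
    rw [one_smul] at e
    obtain ⟨μ, hμ⟩ := comm_traceless hJ hL (sl_ne_zero J) e h2
    have hd := congrArg Matrix.det hμ
    rw [mat_det_smul, J.2, L.2] at hd
    exact hne (pr_eq.2 ⟨μ, by linear_combination -hd, hμ⟩).symm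
  · rw [neg_smul, one_smul] at e
    have hd : ((2 : F)⁻¹ • ((1 + (J : Mat F)) * (1 + (L : Mat F)))).det = 1 := by
      have a1 := mat_det_add 1 (J : Mat F)
      have a2 := mat_det_add 1 (L : Mat F)
      rw [hJ, J.2, one_smul] at a1
      rw [hL, L.2, one_smul] at a2
      rw [mat_det_smul, Matrix.det_mul, a1, a2]
      field_simp
      ring
    let W : SL2 F := ⟨_, hd⟩
    have hW : W * J = L * W := by
      apply Subtype.ext
      rw [Matrix.SpecialLinearGroup.coe_mul, Matrix.SpecialLinearGroup.coe_mul]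
      change ((2 : F)⁻¹ • ((1 + (J : Mat F)) * (1 + (L : Mat F)))) * (J : Mat F) =
        (L : Mat F) * ((2 : F)⁻¹ • ((1 + (J : Mat F)) * (1 + (L : Mat F))))
      rw [Matrix.smul_mul, Matrix.mul_smul]
      congr 1
      have e' : (L : Mat F) * J = -((J : Mat F) * L) := by rw [e, neg_neg]
      have f1 : (J : Mat F) * L * J = L := by
        rw [mul_assoc, e', mul_neg, ← mul_assoc, hJ2]; simp
      have f2 : (L : Mat F) * (J * L) = J := by
        rw [← mul_assoc, e', neg_mul, mul_assoc, hL2]; simp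
      simp only [add_mul, mul_add, one_mul, mul_one, f1, f2, hJ2, hL2, e']
      abel
    refine ⟨(pr F W)⁻¹, ?_⟩
    rw [inv_inv, ← map_mul, hW, map_mul, mul_inv_cancel_right]

theorem card_sl [Fintype F] : Nat.card (SL2 F) * (Fintype.card F - 1) =
    (Fintype.card F ^ 2 - 1) * (Fintype.card F ^ 2 - Fintype.card F) := by
  classical
  have h := Matrix.card_GL_field (𝔽 := F) 2
  rw [Fin.prod_univ_two] at h
  simp only [Fin.val_zero, Fin.val_one, pow_zero, pow_one] at h
  rw [← h]
  let d : GL (Fin 2) F →* Fˣ := Matrix.GeneralLinearGroup.det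
  have hs : Function.Surjective d := by
    intro u
    refine ⟨Matrix.GeneralLinearGroup.mkOfDetNeZero !![(u : F), 0; 0, 1] (by simp), ?_⟩
    ext
    simp [d, Matrix.GeneralLinearGroup.mkOfDetNeZero]
  have hk : Nat.card d.ker = Nat.card (SL2 F) := by
    let f : SL2 F → d.ker := fun A => ⟨Matrix.SpecialLinearGroup.toGL A, by
      rw [MonoidHom.mem_ker]; ext; simp [d]⟩
    refine (Nat.card_eq_of_bijective f ⟨?_, ?_⟩).symm
    · intro A B hAB
      have := congrArg (fun x : d.ker => ((x : GL (Fin 2) F) : Mat F)) hAB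
      exact Subtype.ext this
    · rintro ⟨x, hx⟩
      have : (x : Mat F).det = 1 := by
        have := congrArg (fun u : Fˣ => (u : F)) (MonoidHom.mem_ker.1 hx)
        simpa [d] using this
      refine ⟨⟨(x : Mat F), this⟩, ?_⟩
      apply Subtype.ext
      apply Units.ext
      rfl
  have h1 := Subgroup.card_mul_index d.ker
  rw [Subgroup.index_ker, hk, MonoidHom.range_eq_top.2 hs, Subgroup.card_top, Nat.card_eq_fintype_card (α := Fˣ),
    Fintype.card_units] at h1
  exact h1

theorem card_psl [Fintype F] (h2 : (2 : F) ≠ 0) : Nat.card (PSL2 F) * 2 = Nat.card (SL2 F) := by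
  have h := Subgroup.card_eq_card_quotient_mul_card_subgroup (Subgroup.center (SL2 F))
  rw [h]
  congr 1
  symm
  rw [Nat.card_eq_two_iff]
  have m1 : (-1 : SL2 F) ∈ Subgroup.center (SL2 F) := mem_center_iff'.2 ⟨-1, by ring, by simp⟩
  refine ⟨1, ⟨-1, m1⟩, ?_, ?_⟩
  · intro e
    have e1 := congrArg (fun x : Subgroup.center (SL2 F) => ((x : SL2 F) : Mat F) 0 0) e
    simp at e1
    apply h2
    linear_combination e1
  · ext ⟨x, hx⟩
    simp only [Set.mem_insert_iff, Set.mem_singleton_iff, Set.mem_univ, iff_true]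
    obtain ⟨c, hc, e⟩ := mem_center_iff'.1 hx
    rcases two_sq_one hc with rfl | rfl
    · left; apply Subtype.ext; apply Subtype.ext; rw [e]; simp
    · right; apply Subtype.ext; apply Subtype.ext; rw [e]; simp

variable [Fintype F] {q : ℕ} [Fact q.Prime] [CharP F q]

theorem card_psl' (hF : Fintype.card F = q) (hq2 : q ≠ 2) : Nat.card (PSL2 F) * 2 = q * ((q - 1) * (q + 1)) := by
  have hrc : ringChar F ≠ 2 := by rw [ringChar.eq F q]; exact hq2
  have h2 : (2 : F) ≠ 0 := Ring.two_ne_zero hrc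
  rw [card_psl h2]
  have h := card_sl (F := F)
  rw [hF] at h
  obtain ⟨r, rfl⟩ : ∃ r, q = r + 2 := ⟨q - 2, by have := (Fact.out : q.Prime).two_le; omega⟩
  have e1 : (r + 2) ^ 2 - 1 = (r + 1) * (r + 3) := by
    rw [Nat.sub_eq_iff_eq_add (Nat.one_le_pow _ _ (by omega))]; ring
  have e2 : (r + 2) ^ 2 - (r + 2) = (r + 2) * (r + 1) := by
    rw [Nat.sub_eq_iff_eq_add (by nlinarith)]; ring
  rw [e1, e2] at h
  simp only [Nat.add_sub_cancel, show r + 2 - 1 = r + 1 by omega] at h ⊢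
  apply Nat.eq_of_mul_eq_mul_right (show 0 < r + 1 by omega)
  rw [h]; ring

end fin
end PronPSL

namespace PronPSL
open Matrix

section fin
variable {F : Type*} [Field F]

/-- unipotent element -/
def uni (n : Mat F) (ht : n.trace = 0) (hd : n.det = 0) (t : F) : SL2 F :=
  ⟨(1 : F) • (1 : Mat F) + t • n, by
    rw [mat_det_add, mat_det_smul, Matrix.trace_smul, ht, hd]; simp⟩

theorem uni_val (n : Mat F) (ht : n.trace = 0) (hd : n.det = 0) (t : F) :
    (uni n ht hd t : Mat F) = (1 : F) • (1 : Mat F) + t • n := rfl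

theorem uni_mul (n : Mat F) (ht : n.trace = 0) (hd : n.det = 0) (s t : F) :
    uni n ht hd (s + t) = uni n ht hd s * uni n ht hd t := by
  apply Subtype.ext
  rw [Matrix.SpecialLinearGroup.coe_mul, uni_val, uni_val, uni_val, ab_mul _ ht, hd]
  congr 2 <;> ring

/-- unipotent hom -/
def uniHom (n : Mat F) (ht : n.trace = 0) (hd : n.det = 0) : Multiplicative F →* PSL2 F :=
  MonoidHom.mk' (fun t => pr F (uni n ht hd t.toAdd)) (by
    intro s t
    rw [toAdd_mul, uni_mul, map_mul])

theorem nn_zero {n : Mat F} (ht : n.trace = 0) (hd : n.det = 0) : n * n = 0 := by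
  rw [mat_sq ht, hd]; simp

theorem uniHom_inj (h2 : (2 : F) ≠ 0) {n : Mat F} (ht : n.trace = 0) (hd : n.det = 0) (hn : n ≠ 0) :
    Function.Injective (uniHom n ht hd) := by
  rw [injective_iff_map_eq_one]
  intro t h
  obtain ⟨c, hc, e⟩ := pr_eq_one.1 h
  rw [uni_val] at e
  have e1 := congrArg Matrix.trace e
  rw [ab_trace _ ht, mat_trace_smul_one] at e1
  have hc1 : c = 1 := (mul_left_cancel₀ h2 e1).symm
  rw [hc1] at e
  have : t.toAdd • n = 0 := by simpa using e
  have := (smul_eq_zero.1 this).resolve_right hn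
  exact this

theorem uniHom_mem {n : Mat F} (ht : n.trace = 0) (hd : n.det = 0) (A : SL2 F) :
    pr F A ∈ (uniHom n ht hd).range ↔ ∃ c t : F, c ^ 2 = 1 ∧ (A : Mat F) = c • (1 : Mat F) + t • n := by
  constructor
  · rintro ⟨t, h⟩
    obtain ⟨c, hc, e⟩ := pr_eq.1 h.symm
    refine ⟨c, c * t.toAdd, hc, ?_⟩
    rw [e, uni_val, smul_add, smul_smul, smul_smul, mul_one]
  · rintro ⟨c, t, hc, e⟩
    refine ⟨Multiplicative.ofAdd (c * t), (pr_eq.2 ⟨c, hc, ?_⟩).symm⟩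
    rw [e, uni_val, smul_add, smul_smul, smul_smul, mul_one, toAdd_ofAdd, ← mul_assoc, ← pow_two, hc, one_mul]

theorem nXn {n : Mat F} (ht : n.trace = 0) (hd : n.det = 0) (X : Mat F) : n * X * n = (n * X).trace • n := by
  rw [Matrix.trace_fin_two] at ht
  rw [Matrix.det_fin_two] at hd
  have h1 : n 1 1 = - n 0 0 := by linear_combination ht
  rw [h1] at hd
  ext i j
  fin_cases i <;> fin_cases j <;> simp [Matrix.mul_apply, Fin.sum_univ_two, Matrix.trace_fin_two, h1]
  · linear_combination -X 1 1 * hd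
  · linear_combination X 0 1 * hd
  · linear_combination X 1 0 * hd
  · linear_combination -X 0 0 * hd

theorem det_add_nil {n : Mat F} (ht : n.trace = 0) (hd : n.det = 0) (X : Mat F) (x : F) :
    (X + x • n).det = X.det - x * (X * n).trace := by
  rw [Matrix.trace_fin_two] at ht
  rw [Matrix.det_fin_two] at hd
  have h1 : n 1 1 = - n 0 0 := by linear_combination ht
  rw [h1] at hd
  simp [Matrix.mul_apply, Fin.sum_univ_two, Matrix.trace_fin_two, Matrix.det_fin_two, h1]
  linear_combination x ^ 2 * hd

theorem trace_ne {n m : Mat F} (h2 : (2 : F) ≠ 0) (ht : n.trace = 0) (hd : n.det = 0) (ht' : m.trace = 0) (hd' : m.det = 0)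
    (hn : n ≠ 0) (hp : ∀ μ : F, m ≠ μ • n) : (n * m).trace ≠ 0 := by
  intro h
  have : n * m = m * n := by
    rw [Matrix.trace_fin_two] at ht ht'
    rw [Matrix.det_fin_two] at hd hd'
    have h1 : n 1 1 = - n 0 0 := by linear_combination ht
    have h1' : m 1 1 = - m 0 0 := by linear_combination ht'
    rw [h1] at hd
    rw [h1'] at hd'
    simp [Matrix.mul_apply, Fin.sum_univ_two, Matrix.trace_fin_two, h1, h1'] at h
    have f1 : n 0 0 * m 0 1 - m 0 0 * n 0 1 = 0 := by
      apply pow_eq_zero_iff (two_ne_zero) |>.1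
      linear_combination (-(m 0 1)^2) * hd - (n 0 1)^2 * hd' - n 0 1 * m 0 1 * h
    have f2 : n 0 0 * m 1 0 - m 0 0 * n 1 0 = 0 := by
      apply pow_eq_zero_iff (two_ne_zero) |>.1
      linear_combination (-(m 1 0)^2) * hd - (n 1 0)^2 * hd' - n 1 0 * m 1 0 * h
    have f3 : n 0 1 * m 1 0 - m 0 1 * n 1 0 = 0 := by
      apply pow_eq_zero_iff (two_ne_zero) |>.1
      linear_combination (n 0 1 * m 1 0 + m 0 1 * n 1 0 - 2 * n 0 0 * m 0 0) * h + (4 * m 0 1 * m 1 0) * hd - 4 * (n 0 0)^2 * hd'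
    ext i j
    fin_cases i <;> fin_cases j <;> simp [Matrix.mul_apply, Fin.sum_univ_two, h1, h1']
    · linear_combination f3
    · linear_combination 2 * f1
    · linear_combination -2 * f2
    · linear_combination -f3
  obtain ⟨μ, hμ⟩ := comm_traceless ht ht' hn this h2
  exact hp μ hμ

theorem span4 {n m : Mat F} (ht : n.trace = 0) (hd : n.det = 0) (ht' : m.trace = 0) (hd' : m.det = 0)
    (h1 : (n * m).trace = 1) (A : Mat F) :
    A = (n * m * A).trace • (n * m) + (m * A).trace • n + (n * A).trace • m + (m * n * A).trace • (m * n) := by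
  have e1 : n * m + m * n = 1 := by
    have := mat_ch (n + m)
    rw [Matrix.trace_add, ht, ht', add_zero, zero_smul, zero_sub, add_mul, mul_add, mul_add, nn_zero ht hd,
      nn_zero ht' hd', zero_add, add_zero] at this
    have e2 := congrArg Matrix.trace this
    rw [← neg_smul, mat_trace_smul_one, Matrix.trace_add, Matrix.trace_mul_comm m n, h1] at e2
    have e3 := det_add_nil ht' hd' n 1
    rw [one_smul, hd, h1] at e3
    rw [this, e3]
    simp
  have e2 := nXn ht hd m
  rw [h1, one_smul] at e2
  have e3 := nXn ht' hd' n
  rw [Matrix.trace_mul_comm, h1, one_smul] at e3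
  have g1 : n * m * A * (n * m) = (n * m * A).trace • (n * m) := by
    rw [← mul_assoc, mul_assoc n m A, nXn ht hd, Matrix.smul_mul]
  have g2 : n * m * A * (m * n) = (m * A).trace • n := by
    rw [← mul_assoc, mul_assoc n m A, mul_assoc n, nXn ht' hd', Matrix.mul_smul, Matrix.smul_mul, e2]
  have g3 : m * n * A * (n * m) = (n * A).trace • m := by
    rw [← mul_assoc, mul_assoc m n A, mul_assoc m, nXn ht hd, Matrix.mul_smul, Matrix.smul_mul, e3]
  have g4 : m * n * A * (m * n) = (m * n * A).trace • (m * n) := by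
    rw [← mul_assoc, mul_assoc m n A, nXn ht' hd', Matrix.smul_mul]
  calc A = (n * m + m * n) * A * (n * m + m * n) := by rw [e1]; simp
    _ = _ := by
      rw [add_mul, add_mul, mul_add, mul_add, g1, g2, g3, g4]; abel

theorem gen_aux {n m : Mat F} (ht : n.trace = 0) (hd : n.det = 0) (ht' : m.trace = 0) (hd' : m.det = 0)
    (h1 : (n * m).trace = 1) (A : SL2 F) (hA : (n * (A : Mat F)).trace ≠ 0) :
    ∃ s u t : F, A = uni n ht hd s * uni m ht' hd' u * uni n ht hd t := by
  have h := span4 ht hd ht' hd' h1 (A : Mat F)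
  set α := (n * m * (A : Mat F)).trace
  set β := (m * (A : Mat F)).trace
  set γ := (n * (A : Mat F)).trace with hγ
  set δ := (m * n * (A : Mat F)).trace
  have e2 := nXn ht hd m
  rw [h1, one_smul] at e2
  have e1 : (1 : Mat F) = n * m + m * n := by
    have := span4 ht hd ht' hd' h1 1
    simpa [ht, ht', Matrix.trace_mul_comm m n, h1] using this
  refine ⟨(α - 1) / γ, γ, (δ - 1) / γ, ?_⟩
  set s := (α - 1) / γ with hs
  set t := (δ - 1) / γ with htt
  have hsα : s * γ = α - 1 := by rw [hs]; field_simp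
  have htδ : t * γ = δ - 1 := by rw [htt]; field_simp
  set B := uni n ht hd s * uni m ht' hd' γ * uni n ht hd t with hB
  have hBv : (B : Mat F) = α • (n * m) + (s + t + s * γ * t) • n + γ • m + δ • (m * n) := by
    rw [hB, Matrix.SpecialLinearGroup.coe_mul, Matrix.SpecialLinearGroup.coe_mul, uni_val, uni_val, uni_val]
    simp only [one_smul, add_mul, mul_add, one_mul, mul_one, Matrix.smul_mul, Matrix.mul_smul, e2, nn_zero ht hd]
    rw [show α = s * γ + 1 by rw [hsα]; ring, show δ = t * γ + 1 by rw [htδ]; ring, e1]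
    module
  have hAB : (B : Mat F) = (A : Mat F) + (s + t + s * γ * t - β) • n := by
    rw [hBv]; conv_rhs => rw [h]
    module
  have hdet := congrArg Matrix.det hAB
  rw [det_add_nil ht hd, A.2, B.2, Matrix.trace_mul_comm, ← hγ] at hdet
  have : (s + t + s * γ * t - β) * γ = 0 := by linear_combination hdet
  have := (mul_eq_zero.1 this).resolve_right hA
  rw [this, zero_smul, add_zero] at hAB
  exact Subtype.ext hAB.symm

theorem gen_aux2 {n m : Mat F} (ht : n.trace = 0) (hd : n.det = 0) (ht' : m.trace = 0) (hd' : m.det = 0)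
    (h1 : (n * m).trace = 1) (K : Subgroup (SL2 F)) (hn : ∀ t, uni n ht hd t ∈ K) (hm : ∀ t, uni m ht' hd' t ∈ K)
    (A : SL2 F) : A ∈ K := by
  have key : ∀ A : SL2 F, (n * (A : Mat F)).trace ≠ 0 → A ∈ K := by
    intro A hA
    obtain ⟨s, u, t, e⟩ := gen_aux ht hd ht' hd' h1 A hA
    rw [e]
    exact mul_mem (mul_mem (hn _) (hm _)) (hn _)
  by_cases hA : (n * (A : Mat F)).trace = 0
  · have hα : (n * m * (A : Mat F)).trace ≠ 0 := by
      intro hα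
      have h := span4 ht hd ht' hd' h1 (A : Mat F)
      rw [hA, hα, zero_smul, zero_smul, zero_add, add_zero] at h
      have h' : (A : Mat F) = ((m * (A : Mat F)).trace • (1 : Mat F) + (m * n * (A : Mat F)).trace • m) * n := by
        rw [add_mul, Matrix.smul_mul, Matrix.smul_mul, one_mul]; exact h
      have hh := congrArg Matrix.det h'
      rw [Matrix.det_mul, hd, mul_zero, A.2] at hh
      exact one_ne_zero hh
    have := key (uni m ht' hd' 1 * A) (by
      rw [Matrix.SpecialLinearGroup.coe_mul, uni_val, one_smul, one_smul, add_mul, one_mul, mul_add, ← mul_assoc,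
        Matrix.trace_add, hA, zero_add]
      exact hα)
    exact (K.mul_mem_cancel_left (hm 1)).1 this
  · exact key A hA

variable [Fintype F] {q : ℕ} [Fact q.Prime] [CharP F q]

theorem q_struct (hF : Fintype.card F = q) (hq2 : q ≠ 2) (Q : Subgroup (PSL2 F)) (hQ : Nat.card Q = q) :
    ∃ n : Mat F, n ≠ 0 ∧ n.trace = 0 ∧ n.det = 0 ∧ ∀ A : SL2 F, pr F A ∈ Q ↔
      ∃ c t : F, c ^ 2 = 1 ∧ (A : Mat F) = c • (1 : Mat F) + t • n := by
  have hrc : ringChar F ≠ 2 := by rw [ringChar.eq F q]; exact hq2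
  have h2 : (2 : F) ≠ 0 := Ring.two_ne_zero hrc
  have hq := (Fact.out : q.Prime)
  have : Nontrivial Q := by
    rw [← Finite.one_lt_card_iff_nontrivial, hQ]; exact hq.one_lt
  obtain ⟨⟨u, hu⟩, hu1⟩ := exists_ne (1 : Q)
  have hu1' : u ≠ 1 := fun e => hu1 (Subtype.ext e)
  have hou : orderOf u = q := by
    apply orderOf_eq_prime _ hu1'
    have := pow_card_eq_one' (G := Q) (x := ⟨u, hu⟩)
    rw [hQ] at this
    exact congrArg Subtype.val this
  obtain ⟨A, rfl⟩ := pr_surj u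
  obtain ⟨c, n, e, ht, hd⟩ := sl_decomp h2 A
  have hd0 : n.det = 0 := by
    by_contra hd0
    obtain ⟨ν, hν⟩ := FiniteField.exists_nonsquare hrc
    have hν0 : ν ≠ 0 := by rintro rfl; exact hν (IsSquare.zero)
    obtain ⟨l, hl, hl2⟩ := scale hq2 hν hd0
    let x : Pole F ν := ⟨l • n, by rw [Matrix.trace_smul, ht, smul_zero], by rw [mat_det_smul]; exact hl2⟩
    have hAx : pr F A • x = x := by
      rw [pr_smul_eq, e]
      change _ * (l • n) = (l • n) * _
      simp [add_mul, mul_add]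
      exact smul_comm _ _ _
    have h3 : orderOf (pr F A) ∣ Nat.card (MulAction.stabilizer (PSL2 F) x) := by
      rw [← Subgroup.orderOf_mk (pr F A) (show pr F A ∈ MulAction.stabilizer (PSL2 F) x from hAx)]
      exact orderOf_dvd_natCard _
    rw [hou] at h3
    have hq3 : 3 ≤ q := by have := hq.two_le; omega
    rcases stab_card hF hq2 hν0 x with h | h
    · have := Nat.le_of_dvd (by omega) (h3.trans h); omega
    · have := Nat.le_of_dvd (by omega) (h3.trans h); omega
  rw [hd0, add_zero] at hd
  have hn0 : n ≠ 0 := by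
    rintro rfl
    exact hu1' (pr_eq_one.2 ⟨c, hd, by rw [e, add_zero]⟩)
  have hle : Q ≤ (uniHom n ht hd0).range := by
    have hz : Subgroup.zpowers (pr F A) ≤ Q := by rw [Subgroup.zpowers_le]; exact hu
    have hz2 : Subgroup.zpowers (pr F A) = Q := eq_of_le_card hz (by rw [Nat.card_zpowers, hou, hQ])
    rw [← hz2, Subgroup.zpowers_le, uniHom_mem]
    exact ⟨c, 1, hd, by rw [e, one_smul]⟩
  have heq : Q = (uniHom n ht hd0).range := by
    apply eq_of_le_card hle
    rw [hQ, ← hF, ← Nat.card_eq_fintype_card]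
    have := Nat.card_congr (MonoidHom.ofInjective (uniHom_inj h2 ht hd0 hn0)).toEquiv
    rw [← this]; rfl
  refine ⟨n, hn0, ht, hd0, fun B => ?_⟩
  rw [heq, uniHom_mem]

theorem gen (hF : Fintype.card F = q) (hq2 : q ≠ 2) (Q R : Subgroup (PSL2 F)) (hQ : Nat.card Q = q)
    (hR : Nat.card R = q) (hne : Q ≠ R) : Q ⊔ R = ⊤ := by
  have hrc : ringChar F ≠ 2 := by rw [ringChar.eq F q]; exact hq2
  have h2 : (2 : F) ≠ 0 := Ring.two_ne_zero hrc
  obtain ⟨n, hn, ht, hd, HQ⟩ := q_struct hF hq2 Q hQ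
  obtain ⟨m, hm, ht', hd', HR⟩ := q_struct hF hq2 R hR
  have hp : ∀ μ : F, m ≠ μ • n := by
    intro μ hμ
    apply hne
    symm
    apply eq_of_le_card _ (by rw [hQ, hR])
    intro g hg
    obtain ⟨A, rfl⟩ := pr_surj g
    obtain ⟨c, t, hc, e⟩ := (HR A).1 hg
    exact (HQ A).2 ⟨c, t * μ, hc, by rw [e, hμ, smul_smul]⟩
  have hτ := trace_ne h2 ht hd ht' hd' hn hp
  set τ := (n * m).trace with hτd
  have ht'' : (τ⁻¹ • m).trace = 0 := by rw [Matrix.trace_smul, ht', smul_zero]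
  have hd'' : (τ⁻¹ • m).det = 0 := by rw [mat_det_smul, hd', mul_zero]
  rw [eq_top_iff]
  rintro g -
  obtain ⟨A, rfl⟩ := pr_surj g
  refine gen_aux2 ht hd ht'' hd'' (by rw [Matrix.mul_smul, Matrix.trace_smul, ← hτd, smul_eq_mul, inv_mul_cancel₀ hτ])
    ((Q ⊔ R).comap (pr F)) ?_ ?_ A
  · intro t
    exact (le_sup_left : Q ≤ Q ⊔ R) ((HQ _).2 ⟨1, t, by ring, rfl⟩)
  · intro t
    exact (le_sup_right : R ≤ Q ⊔ R) ((HR _).2 ⟨1, t * τ⁻¹, by ring, by rw [uni_val, smul_smul]⟩)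

theorem norm_mat (h2 : (2 : F) ≠ 0) {Q : Subgroup (PSL2 F)} {n : Mat F} (ht : n.trace = 0) (hd : n.det = 0)
    (HQ : ∀ A : SL2 F, pr F A ∈ Q ↔ ∃ c t : F, c ^ 2 = 1 ∧ (A : Mat F) = c • (1 : Mat F) + t • n) {B : SL2 F}
    (h : Q.conjugate (pr F B) = Q) : ∃ t : F, (B : Mat F) * n = t • (n * (B : Mat F)) := by
  have h1 : pr F (uni n ht hd 1) ∈ Q := (HQ _).2 ⟨1, 1, by ring, rfl⟩
  rw [← h, mem_conj, ← map_mul, ← map_inv, ← map_mul, HQ] at h1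
  obtain ⟨c, t, hc, e⟩ := h1
  rw [Matrix.SpecialLinearGroup.coe_mul, Matrix.SpecialLinearGroup.coe_mul, Matrix.SpecialLinearGroup.coe_inv, uni_val] at e
  have et := congrArg Matrix.trace e
  rw [ab_trace _ ht, Matrix.trace_mul_comm, ← mul_assoc, sl_adj_mul, one_mul, ab_trace _ ht] at et
  have hc1 : c = 1 := (mul_left_cancel₀ h2 et).symm
  have e2 := congrArg (· * (B : Mat F)) e
  simp only [mul_assoc, sl_adj_mul, hc1, mul_one, one_smul, mul_add, add_mul, one_mul, Matrix.smul_mul] at e2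
  exact ⟨t, add_left_cancel e2⟩

theorem comm (hF : Fintype.card F = q) (hq2 : q ≠ 2) (Q : Subgroup (PSL2 F)) (hQ : Nat.card Q = q) (b c : PSL2 F)
    (hb : Q.conjugate b = Q) (hc : Q.conjugate c = Q) : b * c * b⁻¹ * c⁻¹ ∈ Q := by
  have hrc : ringChar F ≠ 2 := by rw [ringChar.eq F q]; exact hq2
  have h2 : (2 : F) ≠ 0 := Ring.two_ne_zero hrc
  obtain ⟨n, hn, ht, hd, HQ⟩ := q_struct hF hq2 Q hQ
  obtain ⟨B, rfl⟩ := pr_surj b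
  obtain ⟨C, rfl⟩ := pr_surj c
  obtain ⟨s, hs⟩ := norm_mat h2 ht hd HQ hb
  obtain ⟨t, htt⟩ := norm_mat h2 ht hd HQ hc
  have hX : ((C * B : SL2 F) : Mat F) * n = (s * t) • (n * ((C * B : SL2 F) : Mat F)) := by
    rw [Matrix.SpecialLinearGroup.coe_mul, mul_assoc, hs, Matrix.mul_smul, ← mul_assoc, htt, Matrix.smul_mul, smul_smul,
      mul_assoc]
  have hY : ((B * C : SL2 F) : Mat F) * n = (s * t) • (n * ((B * C : SL2 F) : Mat F)) := by
    rw [Matrix.SpecialLinearGroup.coe_mul, mul_assoc, htt, Matrix.mul_smul, ← mul_assoc, hs, Matrix.smul_mul, smul_smul,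
      mul_assoc, mul_comm t s]
  set X := C * B
  set Y := B * C
  have hr : s * t ≠ 0 := by
    intro h0
    rw [h0, zero_smul] at hX
    have := congrArg ((X : Mat F).adjugate * ·) hX
    simp only [← mul_assoc, sl_adj_mul, one_mul, mul_zero] at this
    exact hn this
  rw [← map_inv, ← map_inv, ← map_mul, ← map_mul, ← map_mul, HQ]
  set W := B * C * B⁻¹ * C⁻¹ with hWd
  have hWX : W * X = Y := by simp only [hWd, X, Y]; group
  have hWX' : (W : Mat F) * (X : Mat F) = (Y : Mat F) := congrArg Subtype.val hWX
  have hW : (W : Mat F) * n = n * (W : Mat F) := by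
    have h3 : (s * t) • ((W : Mat F) * n * (X : Mat F)) = (s * t) • (n * (W : Mat F) * (X : Mat F)) := by
      rw [mul_assoc, ← Matrix.mul_smul, ← hX, ← mul_assoc, hWX', hY, mul_assoc n, hWX']
    have h4 := smul_right_injective (Mat F) hr h3
    have h5 := congrArg (· * (X : Mat F).adjugate) h4
    simpa only [mul_assoc, sl_mul_adj, mul_one] using h5
  obtain ⟨α, p, e, hp, hpd⟩ := sl_decomp h2 W
  obtain ⟨μ, hμ⟩ := comm_traceless ht hp hn (by
    rw [e, add_mul, mul_add] at hW
    simpa using hW.symm) h2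
  refine ⟨α, μ, ?_, by rw [e, hμ]⟩
  rw [hμ, mat_det_smul, hd] at hpd
  linear_combination hpd

end fin
end PronPSL

namespace PronPSL
open Matrix

theorem arith {q k c n m : ℕ} (hq : q.Prime) (hq2 : q ≠ 2) (hn : 3 ≤ n) (hm : Odd m) (hmq : m < q)
    (hc : c * 2 = q * (2 ^ (n + 1) * m)) (hk : k = c.factorization 2) :
    k = n ∧ ∃ m, Odd m ∧ ¬ q ∣ 2 ^ k * m ∧ c = q * (2 ^ k * m) := by
  have hc' : c = q * (2 ^ n * m) := by
    apply Nat.eq_of_mul_eq_mul_right (show 0 < 2 by norm_num)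
    rw [hc, pow_succ]; ring
  have hm0 : m ≠ 0 := by rintro rfl; simp at hm
  have hm2 : ¬ 2 ∣ m := by
    rintro ⟨r, rfl⟩; exact (Nat.not_odd_iff_even.2 ⟨r, by ring⟩) hm
  have hqd : ¬ 2 ∣ q := fun h => hq2 ((Nat.prime_dvd_prime_iff_eq Nat.prime_two hq).1 h).symm
  have hkn : k = n := by
    rw [hk, hc', Nat.factorization_mul hq.ne_zero (by positivity), Nat.factorization_mul (by positivity) hm0]
    simp [Nat.factorization_eq_zero_of_not_dvd hqd, Nat.factorization_eq_zero_of_not_dvd hm2,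
      Nat.Prime.factorization_pow Nat.prime_two]
  refine ⟨hkn, m, hm, ?_, by rw [hkn]; exact hc'⟩
  rw [hq.dvd_mul]
  rintro (h | h)
  · have := hq.dvd_of_dvd_pow h
    exact hq2 ((Nat.prime_dvd_prime_iff_eq hq Nat.prime_two).1 this)
  · exact absurd (Nat.le_of_dvd (Nat.pos_of_ne_zero hm0) h) (by omega)

theorem arith_all {q k c : ℕ} (hq : q.Prime) (hmod : q % 8 = 1 ∨ q % 8 = 7)
    (hpow2 : (∃ m : ℕ, q - 1 = 2 ^ m) ∨ (∃ m : ℕ, q + 1 = 2 ^ m))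
    (hc : c * 2 = q * ((q - 1) * (q + 1))) (hk : k = c.factorization 2) :
    3 ≤ k ∧ (∃ m, Odd m ∧ ¬ q ∣ 2 ^ k * m ∧ c = q * (2 ^ k * m)) ∧
      ∀ s, s ∣ (q - 1) / 2 ∨ s ∣ (q + 1) / 2 → Odd s ∨ s ∣ 2 ^ (k - 1) := by
  have hq2 : q ≠ 2 := by rintro rfl; omega
  have hq1 := hq.one_lt
  rcases hpow2 with ⟨n, hn⟩ | ⟨n, hn⟩
  · have hn3 : 3 ≤ n := by
      by_contra h
      have : n = 0 ∨ n = 1 ∨ n = 2 := by omega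
      rcases this with rfl | rfl | rfl <;> omega
    obtain ⟨r, rfl⟩ : ∃ r, n = r + 2 := ⟨n - 2, by omega⟩
    have e : 2 ^ (r + 2) = 4 * 2 ^ r := by ring
    have hodd : Odd (2 * 2 ^ r + 1) := ⟨2 ^ r, by ring⟩
    obtain ⟨h1, h2⟩ := arith (q := q) (k := k) (c := c) (n := r + 2) (m := 2 * 2 ^ r + 1) hq hq2 hn3 hodd
      (by have : 0 < 2 ^ r := by positivity
          omega)
      (by rw [hc, hn, show q + 1 = 2 * (2 * 2 ^ r + 1) by omega]; ring) hk
    refine ⟨by omega, h2, ?_⟩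
    have e2 : (q - 1) / 2 = 2 ^ (k - 1) := by
      rw [h1, hn, show r + 2 - 1 = r + 1 by omega, pow_succ, pow_succ, Nat.mul_div_cancel _ (by norm_num)]
    have e3 : (q + 1) / 2 = 2 * 2 ^ r + 1 := by omega
    rintro s (h | h)
    · right; rwa [e2] at h
    · left; rw [e3] at h; exact hodd.of_dvd_nat h
  · have hn3 : 3 ≤ n := by
      by_contra h
      have : n = 0 ∨ n = 1 ∨ n = 2 := by omega
      rcases this with rfl | rfl | rfl <;> omega
    obtain ⟨r, rfl⟩ : ∃ r, n = r + 2 := ⟨n - 2, by omega⟩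
    have e : 2 ^ (r + 2) = 4 * 2 ^ r := by ring
    have hr : 0 < 2 ^ r := by positivity
    have hodd : Odd (2 * 2 ^ r - 1) := ⟨2 ^ r - 1, by omega⟩
    obtain ⟨h1, h2⟩ := arith (q := q) (k := k) (c := c) (n := r + 2) (m := 2 * 2 ^ r - 1) hq hq2 hn3 hodd
      (by omega)
      (by rw [hc, hn, show q - 1 = 2 * (2 * 2 ^ r - 1) by omega]; ring) hk
    refine ⟨by omega, h2, ?_⟩
    have e2 : (q + 1) / 2 = 2 ^ (k - 1) := by
      rw [h1, hn, show r + 2 - 1 = r + 1 by omega, pow_succ, pow_succ, Nat.mul_div_cancel _ (by norm_num)]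
    have e3 : (q - 1) / 2 = 2 * 2 ^ r - 1 := by omega
    rintro s (h | h)
    · left; rw [e3] at h; exact hodd.of_dvd_nat h
    · right; rwa [e2] at h

end PronPSL

theorem stmt5 (q : ℕ) (hq : q.Prime) (hmod : q % 8 = 1 ∨ q % 8 = 7)
    (hq7 : q ≠ 7) (hq17 : q ≠ 17)
    (hpow2 : (∃ m : ℕ, q - 1 = 2 ^ m) ∨ (∃ m : ℕ, q + 1 = 2 ^ m))
    (F : Type*) [Field F] [Fintype F] (hF : Fintype.card F = q)
    (k : ℕ)
    (hk : k = (Nat.card (Matrix.ProjectiveSpecialLinearGroup (Fin 2) F)).factorization 2)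
    (H : Subgroup (Matrix.ProjectiveSpecialLinearGroup (Fin 2) F)) :
    ¬ IsPronormal H ↔
      ∃ j : ℕ, 1 ≤ j ∧ j ≤ k - 2 ∧
        Nonempty (H ≃* DihedralGroup (2 ^ (j - 1))) := by
  have : Fact q.Prime := ⟨hq⟩
  have : CharP F q := charP_of_card_eq_prime (by rw [hF])
  have hq2 : q ≠ 2 := by rintro rfl; omega
  have hq3 : 3 ≤ q := by have := hq.two_le; omega
  have hrc : ringChar F ≠ 2 := by rw [ringChar.eq F q]; exact hq2
  have h2 : (2 : F) ≠ 0 := Ring.two_ne_zero hrc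
  obtain ⟨ν, hν⟩ := FiniteField.exists_nonsquare hrc
  have hν0 : ν ≠ 0 := by rintro rfl; exact hν (IsSquare.zero)
  obtain ⟨hk3, hcard, hst⟩ := PronPSL.arith_all hq hmod hpow2 (PronPSL.card_psl' hF hq2) hk
  let D : PronPSL.PoleData (PronPSL.PSL2 F) (PronPSL.Pole F ν) q k :=
    { neg := PronPSL.pneg
      neg_neg := fun x => Subtype.ext (neg_neg x.1)
      neg_ne := by
        intro x h
        have h1 : -x.1 = x.1 := congrArg Subtype.val h
        have h3 : (2 : F) • x.1 = 0 := by
          rw [two_smul]; nth_rewrite 1 [← h1]; exact neg_add_cancel _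
        exact (smul_eq_zero.1 h3).elim h2 (PronPSL.pole_ne hν0 x)
      smul_neg := by
        intro g x
        obtain ⟨A, rfl⟩ := PronPSL.pr_surj g
        rw [PronPSL.pr_smul_eq]
        have h := (PronPSL.pr_smul_eq (A := A) (v := x)).1 rfl
        change _ * (-x.1) = (-(PronPSL.pr F A • x).1) * _
        rw [mul_neg, neg_mul, h]
      fix := PronPSL.pole_fix hq2 hν
      rev := PronPSL.pole_rev h2 hν0
      cyc := PronPSL.stab_cyclic h2 hν0
      cardstab := fun x => hst _ (PronPSL.stab_card hF hq2 hν0 x)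
      qstab := by
        intro x h3
        rcases PronPSL.stab_card hF hq2 hν0 x with h | h
        · have := Nat.le_of_dvd (by omega) (h3.trans h); omega
        · have := Nat.le_of_dvd (by omega) (h3.trans h); omega
      card := hcard
      hk := hk3
      hq := hq
      hq2 := hq2
      comm := PronPSL.comm hF hq2
      gen := PronPSL.gen hF hq2
      invol := PronPSL.invol h2 }
  exact D.main H
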